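/- There exists a constant C > 0 (depending only on the distribution of ξ) such that for all integers k ≥ 1 and n ≥ 1 (with P(|𝒯| = n) > 0), E Z_k(T_n) ≤ C min(k, √n). -/

import Mathlib

open scoped ENNReal BigOperators
open Set Filter

/-- Plane (ordered rooted) trees. -/
inductive PlaneTree : Type
  | node : List PlaneTree → PlaneTree

namespace PlaneTree

/-- The list of subtrees hanging off the root. -/
def children : PlaneTree → List PlaneTree
  | .node ts => ts

/-- The subtree rooted at a given position (sequence of child indices), if it exists. -/
def subtreeAt : PlaneTree → List ℕ → Option PlaneTree
  | t, [] => some t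
  | .node ts, i :: q =>
    match ts[i]? with
    | some t' => subtreeAt t' q
    | none => none

/-- The vertex set of a tree, with vertices identified with their positions. -/
def vertexSet (t : PlaneTree) : Set (List ℕ) := {q | (subtreeAt t q).isSome}

/-- The number of vertices of a tree. -/
noncomputable def size (t : PlaneTree) : ℕ := (vertexSet t).ncard

/-- The number of children of the vertex at position `q`. -/
def childCount (t : PlaneTree) (q : List ℕ) : ℕ :=
  ((subtreeAt t q).map fun t' => t'.children.length).getD 0

end PlaneTree

/-- Longest common prefix of two positions; this is the position of the last common
ancestor of the two vertices. -/
def lca : List ℕ → List ℕ → List ℕ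
  | a :: as, b :: bs => if a = b then a :: lca as bs else []
  | _, _ => []

/-- The distance from `v` up to the last common ancestor of `v` and `w`. -/
def dUp (v w : List ℕ) : ℕ := v.length - (lca v w).length

/-- The graph distance between the vertices at positions `v` and `w`. -/
def treeDist (v w : List ℕ) : ℕ := dUp v w + dUp w v

/-- The Galton–Watson probability of a given finite tree: the product, over all vertices,
of the probability that the offspring distribution takes the value given by the number of
children of the vertex. -/
noncomputable def gwProb (p : ℕ → ℝ≥0∞) (t : PlaneTree) : ℝ≥0∞ :=
  ∏ᶠ v ∈ PlaneTree.vertexSet t, p (PlaneTree.childCount t v)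

/-- `P(|𝒯| = n)` for the Galton–Watson tree `𝒯`. -/
noncomputable def probSize (p : ℕ → ℝ≥0∞) (n : ℕ) : ℝ≥0∞ :=
  ∑' t : PlaneTree, if PlaneTree.size t = n then gwProb p t else 0

/-- `E f(T_n)` where `T_n` is the Galton–Watson tree conditioned to have `n` vertices. -/
noncomputable def condExp (p : ℕ → ℝ≥0∞) (n : ℕ) (f : PlaneTree → ℝ≥0∞) : ℝ≥0∞ :=
  (∑' t : PlaneTree, if PlaneTree.size t = n then gwProb p t * f t else 0) / probSize p n

/-- The variance of the offspring distribution `p` (which has mean `1`). -/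
noncomputable def xiVar (p : ℕ → ℝ≥0∞) : ℝ≥0∞ :=
  ∑' k : ℕ, p k * ENNReal.ofReal (((k : ℝ) - 1) ^ 2)

/-- `P_k(t)`: the number of unordered pairs of vertices of `t` at graph distance `k`. -/
noncomputable def pairCount (t : PlaneTree) (k : ℕ) : ℕ :=
  {s : Set (List ℕ) | ∃ v w, v ∈ PlaneTree.vertexSet t ∧ w ∈ PlaneTree.vertexSet t ∧
    s = {v, w} ∧ treeDist v w = k}.ncard

/-- `Z_k(t)`: the number of vertices of `t` at graph distance `k` from the root. -/
noncomputable def levelCount (t : PlaneTree) (k : ℕ) : ℕ :=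
  {v | v ∈ PlaneTree.vertexSet t ∧ v.length = k}.ncard

namespace PlaneTree

/-- Induction on plane trees: a property holds for all trees if it passes from the children
of the root to the whole tree. -/
theorem induction_children {P : PlaneTree → Prop}
    (h : ∀ ts : List PlaneTree, (∀ t ∈ ts, P t) → P (.node ts)) (t : PlaneTree) : P t :=
  PlaneTree.rec (motive_1 := P) (motive_2 := fun ts => ∀ t ∈ ts, P t) h
    (by simp) (fun t ts ht hts => by simpa using ⟨ht, hts⟩) t

theorem subtreeAt_nil (t : PlaneTree) : subtreeAt t [] = some t := by
  cases t; simp [subtreeAt]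

theorem subtreeAt_node_cons (ts : List PlaneTree) (i : Fin ts.length) (q : List ℕ) :
    subtreeAt (.node ts) ((i : ℕ) :: q) = subtreeAt ts[i] q := by
  simp [subtreeAt]

theorem childCount_node_nil (ts : List PlaneTree) : childCount (.node ts) [] = ts.length := by
  simp [childCount, subtreeAt_nil, children]

theorem childCount_node_cons (ts : List PlaneTree) (i : Fin ts.length) (q : List ℕ) :
    childCount (.node ts) ((i : ℕ) :: q) = childCount ts[i] q := by
  rw [childCount, subtreeAt_node_cons, childCount]

theorem nil_mem_vertexSet (t : PlaneTree) : [] ∈ vertexSet t := by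
  simp [vertexSet, subtreeAt_nil]

theorem cons_mem_vertexSet_node (ts : List PlaneTree) (i : ℕ) (q : List ℕ) :
    i :: q ∈ vertexSet (.node ts) ↔ ∃ h : i < ts.length, q ∈ vertexSet ts[i] := by
  by_cases h : i < ts.length
  · simpa [vertexSet, h] using
      (congrArg (fun o => o.isSome = true) (subtreeAt_node_cons ts ⟨i, h⟩ q)).to_iff
  · simp [vertexSet, subtreeAt, h]

/-- The vertices of a tree are its root and the vertices of the trees hanging off the root. -/
theorem vertexSet_node (ts : List PlaneTree) :
    vertexSet (.node ts) =
      insert [] (⋃ i : Fin ts.length, List.cons (i : ℕ) '' vertexSet ts[i]) := by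
  ext q
  cases q with
  | nil => simp [nil_mem_vertexSet]
  | cons i q =>
    rw [cons_mem_vertexSet_node]
    simp only [mem_insert_iff, reduceCtorEq, false_or, mem_iUnion, mem_image, List.cons.injEq]
    constructor
    · rintro ⟨h, hq⟩
      exact ⟨⟨i, h⟩, q, hq, rfl, rfl⟩
    · rintro ⟨j, q', hq, rfl, rfl⟩
      exact ⟨j.2, hq⟩

theorem pairwise_disjoint_image_cons {m : ℕ} (s : Fin m → Set (List ℕ)) :
    Pairwise (Function.onFun Disjoint fun i : Fin m => List.cons (i : ℕ) '' s i) := by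
  intro i j hij
  rw [Function.onFun, Set.disjoint_left]
  rintro _ ⟨q, -, rfl⟩ ⟨q', -, h⟩
  exact hij (Fin.ext (List.cons.inj h).1.symm)

theorem nil_notMem_iUnion_image_cons {m : ℕ} (s : Fin m → Set (List ℕ)) :
    [] ∉ ⋃ i : Fin m, List.cons (i : ℕ) '' s i := by
  simp

theorem finite_vertexSet (t : PlaneTree) : (vertexSet t).Finite := by
  induction t using induction_children with
  | h ts ih =>
    rw [vertexSet_node]
    exact (finite_iUnion fun i => (ih _ (List.getElem_mem _)).image _).insert _

theorem ncard_iUnion_image_cons (ts : List PlaneTree) (s : PlaneTree → Set (List ℕ))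
    (hs : ∀ t, (s t).Finite) :
    (⋃ i : Fin ts.length, List.cons (i : ℕ) '' s ts[i]).ncard
      = (ts.map fun t => (s t).ncard).sum := by
  rw [Set.ncard_iUnion_of_finite (fun i => (hs _).image _) (pairwise_disjoint_image_cons _),
    finsum_eq_sum_of_fintype, ← Fin.sum_univ_fun_getElem]
  exact Finset.sum_congr rfl fun i _ => ncard_image_of_injective _ List.cons_injective

theorem size_node (ts : List PlaneTree) : size (.node ts) = (ts.map size).sum + 1 := by
  rw [size, vertexSet_node, ncard_insert_of_notMem (nil_notMem_iUnion_image_cons _)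
    (finite_iUnion fun i => (finite_vertexSet _).image _),
    ncard_iUnion_image_cons ts vertexSet finite_vertexSet]
  rfl

end PlaneTree

section

open PlaneTree PowerSeries

theorem gwProb_node (p : ℕ → ℝ≥0∞) (ts : List PlaneTree) :
    gwProb p (.node ts) = p ts.length * (ts.map (gwProb p)).prod := by
  rw [gwProb, vertexSet_node, finprod_mem_insert _ (nil_notMem_iUnion_image_cons _)
    (finite_iUnion fun i => (finite_vertexSet _).image _), childCount_node_nil,
    finprod_mem_iUnion (pairwise_disjoint_image_cons _) fun i => (finite_vertexSet _).image _,
    finprod_eq_prod_of_fintype, ← Fin.prod_univ_fun_getElem]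
  congr 1
  refine Finset.prod_congr rfl fun i _ => ?_
  rw [finprod_mem_image List.cons_injective.injOn]
  simp only [childCount_node_cons]
  rfl

theorem levelCount_zero (t : PlaneTree) : levelCount t 0 = 1 := by
  rw [levelCount, ncard_eq_one]
  refine ⟨[], ?_⟩
  ext q
  simp only [List.length_eq_zero_iff, mem_ofPred_eq, mem_singleton_iff, and_iff_right_iff_imp]
  rintro rfl
  exact nil_mem_vertexSet t

theorem levelCount_node_succ (ts : List PlaneTree) (k : ℕ) :
    levelCount (.node ts) (k + 1) = (ts.map fun t => levelCount t k).sum := by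
  unfold levelCount
  rw [← ncard_iUnion_image_cons ts (fun t => {v | v ∈ vertexSet t ∧ v.length = k})
    fun t => (finite_vertexSet t).subset fun v hv => hv.1]
  congr 1
  ext q
  cases q with
  | nil => simp
  | cons i q =>
    simp only [mem_ofPred_eq, cons_mem_vertexSet_node, List.length_cons, add_left_inj,
      mem_iUnion, mem_image, List.cons.injEq]
    constructor
    · rintro ⟨⟨h, hq⟩, hk⟩
      exact ⟨⟨i, h⟩, q, ⟨hq, hk⟩, rfl, rfl⟩
    · rintro ⟨j, q', ⟨hq, hk⟩, rfl, rfl⟩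
      exact ⟨⟨j.2, hq⟩, hk⟩

/-- The generating function of the total sizes of trees, weighted by the Galton–Watson
probability times `f`. -/
noncomputable def weightedTreeSeries (p : ℕ → ℝ≥0∞) (f : PlaneTree → ℝ≥0∞) : ℝ≥0∞⟦X⟧ :=
  .mk fun n => ∑' t : PlaneTree, if t.size = n then gwProb p t * f t else 0

/-- The generating function of the total sizes of forests of `m` trees, weighted by the
Galton–Watson probability times `f`. -/
noncomputable def forestSeries (p : ℕ → ℝ≥0∞) (m : ℕ) (f : List PlaneTree → ℝ≥0∞) : ℝ≥0∞⟦X⟧ :=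
  .mk fun n => ∑' ts : List PlaneTree, if ts.length = m ∧ (ts.map size).sum = n then
    (ts.map (gwProb p)).prod * f ts else 0

/-- The coefficientwise sum `∑ c m * E m` of a sequence of power series. -/
noncomputable def tsumSeries (c : ℕ → ℝ≥0∞) (E : ℕ → ℝ≥0∞⟦X⟧) : ℝ≥0∞⟦X⟧ :=
  .mk fun n => ∑' m, c m * coeff n (E m)

theorem tsum_list {α : Type*} (F : List α → ℝ≥0∞) :
    ∑' l, F l = F [] + ∑' a, ∑' l, F (a :: l) := by
  classical
  rw [Summable.tsum_eq_add_tsum_ite' (f := F) [] ENNReal.summable]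
  congr 1
  rw [← ENNReal.tsum_prod' (f := fun x : α × List α => F (x.1 :: x.2))]
  have hinj : Function.Injective fun x : α × List α => x.1 :: x.2 := by
    rintro ⟨a, l⟩ ⟨b, m⟩ h
    simpa using h
  rw [← hinj.tsum_eq]
  · simp
  · intro l hl
    cases l with
    | nil => simp at hl
    | cons a l => exact ⟨(a, l), rfl⟩

theorem tsum_planeTree (F : PlaneTree → ℝ≥0∞) :
    ∑' t, F t = ∑' ts : List PlaneTree, F (.node ts) :=
  (Equiv.tsum_eq (⟨PlaneTree.node, children, fun _ => rfl, fun t => by cases t; rfl⟩ :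
    List PlaneTree ≃ PlaneTree) F).symm

theorem tsumSeries_mul (c : ℕ → ℝ≥0∞) (E : ℕ → ℝ≥0∞⟦X⟧) (R : ℝ≥0∞⟦X⟧) :
    tsumSeries c E * R = tsumSeries c fun m => E m * R := by
  ext n
  simp only [tsumSeries, coeff_mk, coeff_mul, Finset.mul_sum, ← ENNReal.tsum_mul_right]
  rw [Summable.tsum_finsetSum fun _ _ => ENNReal.summable]
  simp only [mul_assoc]

theorem natCast_mul_coeff_pow {R : Type*} [CommSemiring R] (p : ℕ → R) (N s : ℕ) :
    (s : R) * coeff s (mk p ^ (N + 1)) =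
      ((N : R) + 1) * ∑ x ∈ Finset.HasAntidiagonal.antidiagonal s, (x.1 : R) * p x.1 *
        coeff x.2 (mk p ^ N) := by
  have h := congrArg (fun F : R⟦X⟧ => coeff s (X * F))
    (derivative_pow (mk p : R⟦X⟧) (N + 1))
  have h1 : ∀ F : R⟦X⟧, coeff s (X * derivative R F) = s * coeff s F := by
    intro F
    cases s with
    | zero => simp
    | succ s => rw [coeff_succ_X_mul, coeff_derivative]; push_cast; ring
  have h2 : X * derivative R (mk p) = mk fun j => (j : R) * p j := by
    ext j
    cases j with
    | zero => simp
    | succ j => rw [coeff_succ_X_mul, coeff_derivative]; simp; ring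
  simp only [h1] at h
  rw [h, add_tsub_cancel_right, show X * (((N + 1 : ℕ) : R⟦X⟧) * mk p ^ N *
    derivative R (mk p)) = C ((N : R) + 1) * ((X * derivative R (mk p)) * mk p ^ N) by
    simp only [map_add, map_natCast, map_one]; push_cast; ring, h2, coeff_C_mul, coeff_mul]
  simp

section forest

variable (p : ℕ → ℝ≥0∞)

theorem forestSeries_succ (m : ℕ) (g : PlaneTree → ℝ≥0∞) (h : List PlaneTree → ℝ≥0∞)
    (f : List PlaneTree → ℝ≥0∞) (hf : ∀ t ts, f (t :: ts) = g t * h ts) :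
    forestSeries p (m + 1) f = weightedTreeSeries p g * forestSeries p m h := by
  ext n
  simp only [forestSeries, weightedTreeSeries, coeff_mk, coeff_mul, ← ENNReal.tsum_mul_right]
  simp only [← ENNReal.tsum_mul_left]
  rw [tsum_list, ← Summable.tsum_finsetSum (β := PlaneTree) fun _ _ => ENNReal.summable]
  simp only [List.length_nil, Nat.right_eq_add, Nat.add_eq_zero_iff, one_ne_zero, and_false,
    false_and, if_false, zero_add]
  refine tsum_congr fun t => ?_
  rw [← Summable.tsum_finsetSum (β := List PlaneTree) fun _ _ => ENNReal.summable]
  refine tsum_congr fun ts => ?_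
  rw [Finset.sum_eq_ite (t.size, (ts.map size).sum)]
  · simp only [List.length_cons, List.map_cons, List.sum_cons, List.prod_cons, hf]
    by_cases h1 : ts.length = m <;> by_cases h2 : t.size + (ts.map size).sum = n <;>
      simp [h1, h2]
    ring
  · rintro ⟨a, b⟩ - hne
    by_cases h1 : t.size = a
    · by_cases h2 : (ts.map size).sum = b
      · exact absurd (by rw [h1, h2]) hne
      · simp [h2]
    · simp [h1]

theorem forestSeries_add (m : ℕ) (f g : List PlaneTree → ℝ≥0∞) :
    forestSeries p m (fun ts => f ts + g ts) = forestSeries p m f + forestSeries p m g := by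
  ext n
  simp only [forestSeries, coeff_mk, map_add]
  rw [← ENNReal.tsum_add]
  refine tsum_congr fun ts => ?_
  split_ifs <;> simp [mul_add]

theorem forestSeries_zero (f : List PlaneTree → ℝ≥0∞) :
    forestSeries p 0 f = C (f []) := by
  ext n
  rw [forestSeries, coeff_mk, tsum_list]
  simp [coeff_C, eq_comm]

theorem forestSeries_one (m : ℕ) :
    forestSeries p m (fun _ => 1) = weightedTreeSeries p (fun _ => 1) ^ m := by
  induction m with
  | zero => simp [forestSeries_zero]
  | succ m ih =>
    rw [forestSeries_succ p m (fun _ => 1) (fun _ => 1) _ (by simp), ih, pow_succ']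

theorem forestSeries_sum (m : ℕ) (f : PlaneTree → ℝ≥0∞) :
    forestSeries p (m + 1) (fun ts => (ts.map f).sum) =
      C ((m : ℝ≥0∞) + 1) * (weightedTreeSeries p (fun _ => 1) ^ m * weightedTreeSeries p f) := by
  have key : ∀ m, forestSeries p (m + 1) (fun ts => (ts.map f).sum) =
      weightedTreeSeries p f * weightedTreeSeries p (fun _ => 1) ^ m +
      weightedTreeSeries p (fun _ => 1) * forestSeries p m (fun ts => (ts.map f).sum) := by
    intro m
    have h1 := forestSeries_succ p m f (fun _ => 1) (fun ts => (ts.map f).headI) (by simp)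
    have h2 := forestSeries_succ p m (fun _ => 1) (fun ts => (ts.map f).sum)
      (fun ts => (ts.map f).tail.sum) (by simp)
    rw [← forestSeries_one, ← h1, ← h2, ← forestSeries_add]
    congr 1
    ext ts
    cases ts <;> simp [default]
  induction m with
  | zero => rw [key, forestSeries_zero]; simp
  | succ m ih =>
    rw [key, ih]
    push_cast
    simp only [map_add, map_one]
    ring

theorem weightedTreeSeries_eq (f : PlaneTree → ℝ≥0∞) :
    weightedTreeSeries p f =
      X * tsumSeries p fun m => forestSeries p m fun ts => f (.node ts) := by
  ext n
  cases n with
  | zero => simp [weightedTreeSeries, tsum_planeTree, size_node]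
  | succ n =>
    rw [coeff_succ_X_mul, weightedTreeSeries, coeff_mk, tsum_planeTree, tsumSeries, coeff_mk]
    simp only [forestSeries, coeff_mk, ← ENNReal.tsum_mul_left]
    rw [ENNReal.tsum_comm]
    refine tsum_congr fun ts => ?_
    rw [tsum_eq_single ts.length]
    · simp only [size_node, add_left_inj, true_and, gwProb_node, mul_ite, mul_zero, mul_assoc]
    · intro m hm
      simp [hm.symm]

/-- The generating function of the total size of a Galton–Watson tree. -/
noncomputable def treeSeries : ℝ≥0∞⟦X⟧ := weightedTreeSeries p fun _ => 1

theorem coeff_treeSeries (n : ℕ) : coeff n (treeSeries p) = probSize p n := by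
  simp [treeSeries, weightedTreeSeries, probSize]

theorem treeSeries_eq : treeSeries p = X * tsumSeries p fun m => treeSeries p ^ m := by
  have h := weightedTreeSeries_eq p fun _ => 1
  simp only [forestSeries_one] at h
  exact h

/-- The size-biased law of the number of siblings. -/
noncomputable def siblingLaw (m : ℕ) : ℝ≥0∞ := ((m : ℝ≥0∞) + 1) * p (m + 1)

/-- The power series `H k` for which `X ^ k * H k` is the generating function of trees with a
marked vertex at level `k`. -/
noncomputable def spineSeries : ℕ → ℝ≥0∞⟦X⟧
  | 0 => treeSeries p
  | k + 1 => tsumSeries (siblingLaw p) fun m => treeSeries p ^ m * spineSeries k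

theorem levelSeries_eq (k : ℕ) :
    weightedTreeSeries p (fun t => (levelCount t k : ℝ≥0∞)) = X ^ k * spineSeries p k := by
  induction k with
  | zero => simp [levelCount_zero, spineSeries, treeSeries]
  | succ k ih =>
    rw [weightedTreeSeries_eq, pow_succ', mul_assoc]
    congr 1
    rw [spineSeries, mul_comm, tsumSeries_mul]
    ext n
    simp only [tsumSeries, coeff_mk]
    rw [tsum_eq_zero_add' ENNReal.summable]
    simp only [levelCount_node_succ, forestSeries_zero, List.map_nil, List.sum_nil,
      Nat.cast_zero, map_zero, mul_zero, zero_add]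
    refine tsum_congr fun m => ?_
    have := forestSeries_sum p m fun t => (levelCount t k : ℝ≥0∞)
    rw [show (fun ts : List PlaneTree => (((ts.map fun t => levelCount t k).sum : ℕ) : ℝ≥0∞)) =
      fun ts => (ts.map fun t => (levelCount t k : ℝ≥0∞)).sum by ext ts; simp [Function.comp_def],
      this, coeff_C_mul, ih, siblingLaw, treeSeries]
    rw [show ∀ a b c : ℝ≥0∞⟦X⟧, a * (b * c) = a * c * b by intros; ring]
    ring

/-- The transition operator of the random walk with steps `siblingLaw p`. -/
noncomputable def spineOp (B : ℕ → ℝ≥0∞) (l : ℕ) : ℝ≥0∞ := ∑' m, siblingLaw p m * B (m + l)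

theorem coeff_pow_mul_spineSeries (k l N : ℕ) :
    coeff N (treeSeries p ^ l * spineSeries p k) =
      (spineOp p)^[k] (fun l => coeff N (treeSeries p ^ l)) (l + 1) := by
  induction k generalizing l with
  | zero => simp [spineSeries, pow_succ]
  | succ k ih =>
    rw [spineSeries, mul_comm, tsumSeries_mul, Function.iterate_succ_apply', spineOp, tsumSeries,
      coeff_mk]
    refine tsum_congr fun m => ?_
    rw [mul_right_comm, ← pow_add, ih, add_assoc]

/-- The numerator of `E Z_k(T_n)` in terms of coefficients of powers of the tree series. -/
theorem coeff_levelSeries (k N : ℕ) :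
    coeff (N + k) (weightedTreeSeries p fun t => (levelCount t k : ℝ≥0∞)) =
      (spineOp p)^[k] (fun l => coeff N (treeSeries p ^ l)) 1 := by
  rw [levelSeries_eq, coeff_X_pow_mul]
  simpa using coeff_pow_mul_spineSeries p k 0 N

theorem coeff_levelSeries_of_lt {k n : ℕ} (h : n < k) :
    coeff n (weightedTreeSeries p fun t => (levelCount t k : ℝ≥0∞)) = 0 := by
  rw [levelSeries_eq, coeff_X_pow_mul', if_neg (not_le.mpr h)]

theorem coeff_zero_treeSeries_pow_succ (l : ℕ) : coeff 0 (treeSeries p ^ (l + 1)) = 0 := by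
  rw [pow_succ, treeSeries_eq]
  simp

theorem coeff_succ_treeSeries_pow_succ (N l : ℕ) :
    coeff (N + 1) (treeSeries p ^ (l + 1)) = ∑' j, p j * coeff N (treeSeries p ^ (j + l)) := by
  conv_lhs => rw [pow_succ', treeSeries_eq, mul_assoc, coeff_succ_X_mul, ← treeSeries_eq,
    tsumSeries_mul, tsumSeries, coeff_mk]
  simp only [pow_add]

/-- The hitting time formula of Otter and Dwass for the total size of a forest. -/
theorem natCast_mul_coeff_treeSeries_pow (N l : ℕ) :
    (l ≤ N → (N : ℝ≥0∞) * coeff N (treeSeries p ^ l) = l * coeff (N - l) (mk p ^ N)) ∧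
      (N < l → coeff N (treeSeries p ^ l) = 0) := by
  induction N generalizing l with
  | zero =>
    refine ⟨fun h => ?_, fun h => ?_⟩
    · simp [Nat.le_zero.mp h]
    · obtain ⟨l, rfl⟩ := Nat.exists_eq_add_of_lt h
      rw [zero_add]
      exact coeff_zero_treeSeries_pow_succ p l
  | succ N ih =>
    cases l with
    | zero => simp [coeff_one]
    | succ l =>
      rw [coeff_succ_treeSeries_pow_succ]
      constructor
      · intro h
        have hl : l ≤ N := by lia
        rcases Nat.eq_zero_or_pos N with rfl | hN
        · obtain rfl : l = 0 := by lia
          rw [tsum_eq_single 0]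
          · simp
          · intro j hj
            rw [(ih (j + 0)).2 (by lia), mul_zero]
        · have hN0 : (N : ℝ≥0∞) ≠ 0 := by positivity
          refine (ENNReal.mul_right_inj hN0 (ENNReal.natCast_ne_top N)).mp ?_
          have e1 : (N : ℝ≥0∞) * ∑' j, p j * coeff N (treeSeries p ^ (j + l)) =
              ∑ x ∈ Finset.HasAntidiagonal.antidiagonal (N - l), p x.1 *
                (((x.1 : ℝ≥0∞) + l) * coeff x.2 (mk p ^ N)) := by
            rw [← ENNReal.tsum_mul_left, tsum_eq_sum (s := Finset.range (N - l + 1)),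
              Finset.Nat.sum_antidiagonal_eq_sum_range_succ
                (fun i j => p i * (((i : ℝ≥0∞) + l) * coeff j (mk p ^ N)))]
            · refine Finset.sum_congr rfl fun j hj => ?_
              have hj' : j + l ≤ N := by simp at hj; lia
              rw [mul_left_comm, (ih (j + l)).1 hj']
              push_cast
              rw [show N - (j + l) = N - l - j by lia]
            · intro j hj
              rw [(ih (j + l)).2 (by simp at hj; lia)]
              simp
          have e2 : coeff (N - l) (mk p ^ (N + 1)) =
              ∑ x ∈ Finset.HasAntidiagonal.antidiagonal (N - l), p x.1 * coeff x.2 (mk p ^ N) := by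
            simp [pow_succ', coeff_mul]
          have e3 := natCast_mul_coeff_pow p N (N - l)
          have hcast : (N : ℝ≥0∞) = ((N - l : ℕ) : ℝ≥0∞) + l := by
            norm_cast
            lia
          rw [show N + 1 - (l + 1) = N - l by lia, mul_left_comm, e1]
          have e4 : ∑ x ∈ Finset.HasAntidiagonal.antidiagonal (N - l), p x.1 *
                (((x.1 : ℝ≥0∞) + l) * coeff x.2 (mk p ^ N)) =
              ∑ x ∈ Finset.HasAntidiagonal.antidiagonal (N - l),
                (x.1 : ℝ≥0∞) * p x.1 * coeff x.2 (mk p ^ N) +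
              l * coeff (N - l) (mk p ^ (N + 1)) := by
            rw [e2, Finset.mul_sum, ← Finset.sum_add_distrib]
            exact Finset.sum_congr rfl fun x _ => by ring
          rw [e4, mul_add]
          push_cast
          rw [← e3]
          generalize coeff (N - l) (mk p ^ (N + 1)) = a
          rw [← mul_assoc, ← add_mul, ← mul_assoc]
          congr 1
          calc ((N - l : ℕ) : ℝ≥0∞) + (N + 1) * l = (((N - l : ℕ) : ℝ≥0∞) + l) + N * l := by ring
            _ = N * (l + 1) := by rw [← hcast]; ring
      · intro h
        rw [ENNReal.tsum_eq_zero]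
        intro j
        rw [(ih (j + l)).2 (by lia), mul_zero]

end forest

open Complex in
/-- The value of a power series at `exp (i t)`. -/
noncomputable def circleSum (F : ℝ⟦X⟧) (t : ℝ) : ℂ :=
  ∑' j : ℕ, ((coeff j F : ℝ) : ℂ) * cexp ((j * t : ℝ) * I)

section circleSum

variable {F G : ℝ⟦X⟧}

theorem norm_circleSum_term (F : ℝ⟦X⟧) (j : ℕ) (t : ℝ) :
    ‖((coeff j F : ℝ) : ℂ) * Complex.exp ((j * t : ℝ) * Complex.I)‖ = |coeff j F| := by
  rw [norm_mul, Complex.norm_exp_ofReal_mul_I, mul_one, Complex.norm_real, Real.norm_eq_abs]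

theorem hasSum_circleSum (hF : Summable fun j => |coeff j F|) (t : ℝ) :
    HasSum (fun j : ℕ => ((coeff j F : ℝ) : ℂ) * Complex.exp ((j * t : ℝ) * Complex.I))
      (circleSum F t) :=
  (Summable.of_norm (by simpa only [norm_circleSum_term] using hF)).hasSum

theorem continuous_circleSum (hF : Summable fun j => |coeff j F|) : Continuous (circleSum F) :=
  continuous_tsum (fun j => by fun_prop) hF fun j t => (norm_circleSum_term F j t).le

theorem coeff_mul_exp_eq (F G : ℝ⟦X⟧) (n : ℕ) (t : ℝ) :
    ((coeff n (F * G) : ℝ) : ℂ) * Complex.exp ((n * t : ℝ) * Complex.I) =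
      ∑ x ∈ Finset.HasAntidiagonal.antidiagonal n,
        (((coeff x.1 F : ℝ) : ℂ) * Complex.exp ((x.1 * t : ℝ) * Complex.I)) *
        (((coeff x.2 G : ℝ) : ℂ) * Complex.exp ((x.2 * t : ℝ) * Complex.I)) := by
  rw [coeff_mul]
  push_cast
  rw [Finset.sum_mul]
  refine Finset.sum_congr rfl fun x hx => ?_
  rw [mul_mul_mul_comm, ← Complex.exp_add, ← (Finset.HasAntidiagonal.mem_antidiagonal.mp hx)]
  push_cast
  ring_nf

theorem summable_abs_coeff_mul (hF : Summable fun j => |coeff j F|)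
    (hG : Summable fun j => |coeff j G|) : Summable fun j => |coeff j (F * G)| := by
  simpa only [coeff_mul, Real.norm_eq_abs] using
    summable_norm_sum_mul_antidiagonal_of_summable_norm (f := fun j => coeff j F)
      (g := fun j => coeff j G) hF hG

theorem circleSum_mul (hF : Summable fun j => |coeff j F|) (hG : Summable fun j => |coeff j G|)
    (t : ℝ) : circleSum (F * G) t = circleSum F t * circleSum G t := by
  rw [circleSum, circleSum, circleSum, tsum_mul_tsum_eq_tsum_sum_antidiagonal_of_summable_norm
    (by simpa only [norm_circleSum_term] using hF) (by simpa only [norm_circleSum_term] using hG)]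
  exact tsum_congr fun n => coeff_mul_exp_eq F G n t

theorem summable_abs_coeff_one : Summable fun j => |coeff j (1 : ℝ⟦X⟧)| :=
  summable_of_ne_finset_zero (s := {0}) fun j hj => by
    rw [coeff_one, if_neg (by simpa using hj), abs_zero]

theorem circleSum_one (t : ℝ) : circleSum 1 t = 1 := by
  rw [circleSum, tsum_eq_single 0]
  · simp
  · intro j hj
    simp [coeff_one, hj]

theorem summable_abs_coeff_pow (hF : Summable fun j => |coeff j F|) (N : ℕ) :
    Summable fun j => |coeff j (F ^ N)| := by
  induction N with
  | zero => simpa using summable_abs_coeff_one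
  | succ N ih => rw [pow_succ]; exact summable_abs_coeff_mul ih hF

theorem circleSum_pow (hF : Summable fun j => |coeff j F|) (N : ℕ) (t : ℝ) :
    circleSum (F ^ N) t = circleSum F t ^ N := by
  induction N with
  | zero => simpa using circleSum_one t
  | succ N ih => rw [pow_succ, circleSum_mul (summable_abs_coeff_pow hF N) hF, ih, pow_succ]

theorem dvd_of_coeff_mul_ne_zero {d : ℕ} (hF : ∀ j, coeff j F ≠ 0 → d ∣ j)
    (hG : ∀ j, coeff j G ≠ 0 → d ∣ j) (j : ℕ) (h : coeff j (F * G) ≠ 0) : d ∣ j := by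
  rw [coeff_mul] at h
  obtain ⟨x, hx, hne⟩ := Finset.exists_ne_zero_of_sum_ne_zero h
  rw [← Finset.HasAntidiagonal.mem_antidiagonal.mp hx]
  exact dvd_add (hF _ (left_ne_zero_of_mul hne)) (hG _ (right_ne_zero_of_mul hne))

theorem dvd_of_coeff_pow_ne_zero {d : ℕ} (hF : ∀ j, coeff j F ≠ 0 → d ∣ j) (N : ℕ) :
    ∀ j, coeff j (F ^ N) ≠ 0 → d ∣ j := by
  induction N with
  | zero =>
    intro j hj
    by_cases h : j = 0
    · simp [h]
    · simp [coeff_one, h] at hj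
  | succ N ih => rw [pow_succ]; exact dvd_of_coeff_mul_ne_zero ih hF

theorem integral_exp_lattice {d : ℕ} (hd : 0 < d) {m : ℤ} (hdm : (d : ℤ) ∣ m) :
    ∫ t in (-(Real.pi / d))..(Real.pi / d), Complex.exp ((m * t : ℝ) * Complex.I) =
      if m = 0 then ((2 * Real.pi / d : ℝ) : ℂ) else 0 := by
  have hd' : (d : ℝ) ≠ 0 := by positivity
  split_ifs with hm
  · subst hm
    simp only [Int.cast_zero, zero_mul, Complex.ofReal_zero, Complex.exp_zero,
      intervalIntegral.integral_const]
    rw [Complex.real_smul, mul_one]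
    congr 1
    ring
  · obtain ⟨k, rfl⟩ := hdm
    have hm' : (((d : ℤ) * k : ℤ) : ℂ) * Complex.I ≠ 0 :=
      mul_ne_zero (by exact_mod_cast hm) Complex.I_ne_zero
    have h := integral_exp_mul_complex (a := -(Real.pi / d)) (b := Real.pi / d) hm'
    rw [show (fun t : ℝ => Complex.exp (((((d : ℤ) * k : ℤ) : ℝ) * t : ℝ) * Complex.I)) =
      fun t : ℝ => Complex.exp ((((d : ℤ) * k : ℤ) : ℂ) * Complex.I * t) by
        ext t; push_cast; ring_nf, h, div_eq_zero_iff]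
    left
    have hdc : (d : ℂ) ≠ 0 := by exact_mod_cast hd'
    rw [sub_eq_zero, Complex.exp_eq_exp_iff_exists_int]
    refine ⟨k, ?_⟩
    push_cast
    field_simp
    ring

/-- Fourier inversion on the lattice `d ℤ`. -/
theorem coeff_eq_integral_circleSum (hF : Summable fun j => |coeff j F|) {d : ℕ} (hd : 0 < d)
    (hdF : ∀ j, coeff j F ≠ 0 → d ∣ j) {s : ℕ} (hs : d ∣ s) :
    ∫ t in (-(Real.pi / d))..(Real.pi / d),
      circleSum F t * Complex.exp (-(s * t : ℝ) * Complex.I) =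
      ((2 * Real.pi / d : ℝ) : ℂ) * ((coeff s F : ℝ) : ℂ) := by
  have hterm : ∀ (j : ℕ) (t : ℝ), ((coeff j F : ℝ) : ℂ) * Complex.exp ((j * t : ℝ) * Complex.I) *
      Complex.exp (-(s * t : ℝ) * Complex.I) =
      ((coeff j F : ℝ) : ℂ) * Complex.exp ((((j : ℤ) - (s : ℤ) : ℤ) * t : ℝ) * Complex.I) := by
    intro j t
    rw [mul_assoc, ← Complex.exp_add]
    push_cast
    ring_nf
  have h := intervalIntegral.hasSum_integral_of_dominated_convergence
    (a := -(Real.pi / d)) (b := Real.pi / d) (μ := MeasureTheory.volume)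
    (F := fun (j : ℕ) (t : ℝ) => ((coeff j F : ℝ) : ℂ) * Complex.exp ((j * t : ℝ) * Complex.I) *
      Complex.exp (-(s * t : ℝ) * Complex.I))
    (f := fun t => circleSum F t * Complex.exp (-(s * t : ℝ) * Complex.I))
    (fun j _ => |coeff j F|)
    (fun j => by
      refine Continuous.aestronglyMeasurable ?_
      fun_prop)
    (fun j => MeasureTheory.ae_of_all _ fun t _ => by
      rw [norm_mul, norm_circleSum_term, ← Complex.ofReal_neg, Complex.norm_exp_ofReal_mul_I,
        mul_one])
    (MeasureTheory.ae_of_all _ fun t _ => hF)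
    (by simp)
    (MeasureTheory.ae_of_all _ fun t _ => (hasSum_circleSum hF t).mul_right _)
  rw [← h.tsum_eq, tsum_eq_single s]
  · simp only [hterm]
    rw [intervalIntegral.integral_const_mul, integral_exp_lattice hd (by simp)]
    simp [mul_comm]
  · intro j hj
    simp only [hterm]
    rw [intervalIntegral.integral_const_mul]
    by_cases hc : coeff j F = 0
    · simp [hc]
    · rw [integral_exp_lattice hd, if_neg (by lia), mul_zero]
      exact dvd_sub (by exact_mod_cast hdF j hc) (by exact_mod_cast hs)

theorem abs_coeff_le_of_norm_circleSum_le (hF : Summable fun j => |coeff j F|) {d : ℕ}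
    (hd : 0 < d) (hdF : ∀ j, coeff j F ≠ 0 → d ∣ j) {M b : ℝ} (hM : 0 ≤ M) (hb : 0 < b)
    (hbound : ∀ t, |t| ≤ Real.pi / d → ‖circleSum F t‖ ≤ M * Real.exp (-b * t ^ 2)) (s : ℕ) :
    |coeff s F| ≤ d * M / √b := by
  have hd' : (0 : ℝ) < d := by positivity
  by_cases hs : d ∣ s
  swap
  · rw [not_imp_comm.mp (hdF s) hs, abs_zero]
    positivity
  have h := coeff_eq_integral_circleSum hF hd hdF hs
  have hgauss : MeasureTheory.Integrable fun t : ℝ => M * Real.exp (-b * t ^ 2) :=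
    (integrable_exp_neg_mul_sq hb).const_mul M
  have hle : -(Real.pi / d) ≤ Real.pi / d := by
    have : 0 ≤ Real.pi / d := by positivity
    linarith
  have h1 := intervalIntegral.norm_integral_le_of_norm_le (μ := MeasureTheory.volume) hle
    (f := fun t => circleSum F t * Complex.exp (-(s * t : ℝ) * Complex.I))
    (g := fun t => M * Real.exp (-b * t ^ 2))
    (MeasureTheory.ae_of_all _ fun t ht => by
      rw [norm_mul, ← Complex.ofReal_neg, Complex.norm_exp_ofReal_mul_I, mul_one]
      exact hbound t (abs_le.mpr ⟨ht.1.le, ht.2⟩))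
    hgauss.intervalIntegrable
  rw [h, intervalIntegral.integral_of_le hle] at h1
  have h2 := h1.trans (MeasureTheory.setIntegral_le_integral hgauss
    (MeasureTheory.ae_of_all _ fun t => by positivity))
  rw [MeasureTheory.integral_const_mul, integral_gaussian, norm_mul, Complex.norm_real,
    Complex.norm_real, Real.norm_eq_abs, Real.norm_eq_abs, abs_of_pos (by positivity)] at h2
  have hpi : √(Real.pi / b) ≤ 2 * Real.pi / √b := by
    rw [Real.sqrt_div Real.pi_pos.le]
    gcongr
    rw [Real.sqrt_le_left (by positivity)]
    nlinarith [Real.pi_gt_three]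
  rw [le_div_iff₀ (Real.sqrt_pos.mpr hb)]
  have h3 : 2 * Real.pi / d * |coeff s F| ≤ M * (2 * Real.pi / √b) := h2.trans (by gcongr)
  have hsb : 0 < √b := Real.sqrt_pos.mpr hb
  have hpp := Real.pi_pos
  field_simp at h3
  linarith

end circleSum

/-- A probability law on `ℕ` with mean `1` and variance `v`, where `0 < v < ∞`. -/
structure IsCriticalLaw (r : ℕ → ℝ) (v : ℝ) : Prop where
  nonneg : ∀ j, 0 ≤ r j
  hasSum_one : HasSum r 1
  hasSum_mean : HasSum (fun j : ℕ => (j : ℝ) * r j) 1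
  hasSum_variance : HasSum (fun j : ℕ => r j * ((j : ℝ) - 1) ^ 2) v
  variance_pos : 0 < v

namespace IsCriticalLaw

variable {r : ℕ → ℝ} {v : ℝ}

theorem hasSum_centered (hr : IsCriticalLaw r v) : HasSum (fun j : ℕ => ((j : ℝ) - 1) * r j) 0 := by
  simpa [sub_mul] using hr.hasSum_mean.sub hr.hasSum_one

theorem zero_pos (hr : IsCriticalLaw r v) : 0 < r 0 := by
  refine (hr.nonneg 0).lt_of_ne fun h0 => hr.variance_pos.ne ?_
  have hnn : ∀ j : ℕ, 0 ≤ ((j : ℝ) - 1) * r j := by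
    intro j
    rcases Nat.eq_zero_or_pos j with rfl | hj
    · simp [← h0]
    · have : (1 : ℝ) ≤ j := by exact_mod_cast hj
      exact mul_nonneg (by linarith) (hr.nonneg j)
  have hz := (hasSum_zero_iff_of_nonneg hnn).mp hr.hasSum_centered
  refine (hr.hasSum_variance.unique ?_).symm
  convert! (hasSum_zero : HasSum (fun _ : ℕ => (0 : ℝ)) 0) using 2 with j
  have := congrFun hz j
  simp only [Pi.zero_apply] at this
  rw [sq, ← mul_assoc, mul_comm (r j), this, zero_mul]

theorem exists_two_le (hr : IsCriticalLaw r v) : ∃ j, 2 ≤ j ∧ 0 < r j := by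
  by_contra! h
  have h' : ∀ j, 2 ≤ j → r j = 0 := fun j hj => le_antisymm (h j hj) (hr.nonneg j)
  have h0 : ∑' j : ℕ, ((j : ℝ) - 1) * r j = -r 0 := by
    rw [tsum_eq_single 0]
    · simp
    · intro j hj
      rcases Nat.lt_or_ge j 2 with h2 | h2
      · obtain rfl : j = 1 := by lia
        simp
      · simp [h' j h2]
  rw [hr.hasSum_centered.tsum_eq] at h0
  linarith [hr.zero_pos]

theorem summable_abs (hr : IsCriticalLaw r v) : Summable fun j => |coeff j (PowerSeries.mk r)| := by
  simpa [abs_of_nonneg (hr.nonneg _)] using hr.hasSum_one.summable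

theorem hasSum_one_sub_cos (hr : IsCriticalLaw r v) (t : ℝ) :
    HasSum (fun j : ℕ => r j * (1 - Real.cos (j * t)))
      (1 - (circleSum (PowerSeries.mk r) t).re) := by
  have h := Complex.hasSum_re (hasSum_circleSum hr.summable_abs t)
  refine (hr.hasSum_one.sub h).congr_fun fun j => ?_
  rw [coeff_mk, Complex.re_ofReal_mul, Complex.exp_ofReal_mul_I_re]
  ring

theorem norm_sq_circleSum_le (hr : IsCriticalLaw r v) (t : ℝ) :
    ‖circleSum (PowerSeries.mk r) t‖ ^ 2 ≤
      1 - 2 * r 0 * (1 - (circleSum (PowerSeries.mk r) t).re) := by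
  have h1 := (hasSum_nat_add_iff' 1).mpr (hasSum_circleSum hr.summable_abs t)
  have h2 := (hasSum_nat_add_iff' 1).mpr hr.hasSum_one
  have h3 := h1.norm_le_of_bounded h2 fun j => by
    rw [norm_circleSum_term, coeff_mk, abs_of_nonneg (hr.nonneg _)]
  simp only [Finset.range_one, Finset.sum_singleton, coeff_mk, Nat.cast_zero, zero_mul,
    Complex.ofReal_zero, Complex.exp_zero, mul_one] at h3
  have h4 : ‖circleSum (PowerSeries.mk r) t - r 0‖ ^ 2 ≤ (1 - r 0) ^ 2 := by gcongr
  rw [Complex.sq_norm, Complex.normSq_apply] at h4 ⊢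
  simp only [Complex.sub_re, Complex.ofReal_re, Complex.sub_im, Complex.ofReal_im] at h4
  nlinarith

theorem exists_sin_sq_le (hr : IsCriticalLaw r v) {x : ℤ}
    (hx : x ∈ AddSubgroup.closure {x : ℤ | ∃ j : ℕ, r j ≠ 0 ∧ x = j}) :
    ∃ K : ℝ, 0 ≤ K ∧ ∀ t : ℝ,
      Real.sin (x * t / 2) ^ 2 ≤ K * (1 - (circleSum (PowerSeries.mk r) t).re) := by
  have hnn : ∀ t, 0 ≤ 1 - (circleSum (PowerSeries.mk r) t).re := fun t =>
    (hr.hasSum_one_sub_cos t).nonneg fun j =>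
      mul_nonneg (hr.nonneg j) (by linarith [Real.cos_le_one (j * t)])
  induction hx using AddSubgroup.closure_induction with
  | mem x hx =>
    obtain ⟨j, hj, rfl⟩ := hx
    have hj' : 0 < r j := (hr.nonneg j).lt_of_ne' hj
    refine ⟨1 / (2 * r j), by positivity, fun t => ?_⟩
    have h := le_hasSum (hr.hasSum_one_sub_cos t) j fun i _ =>
      mul_nonneg (hr.nonneg i) (by linarith [Real.cos_le_one (i * t)])
    have hc : Real.cos (j * t) = 1 - 2 * Real.sin (j * t / 2) ^ 2 := by
      rw [show (j : ℝ) * t = 2 * (j * t / 2) by ring, Real.cos_two_mul,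
        show 2 * ((j : ℝ) * t / 2) / 2 = j * t / 2 by ring]
      linarith [Real.sin_sq_add_cos_sq (j * t / 2)]
    rw [hc] at h
    push_cast
    rw [div_mul_eq_mul_div, le_div_iff₀ (by positivity)]
    linarith
  | zero => exact ⟨0, le_rfl, fun t => by simp⟩
  | add x y _ _ hx hy =>
    obtain ⟨K, hK, h1⟩ := hx
    obtain ⟨L, hL, h2⟩ := hy
    refine ⟨2 * (K + L), by positivity, fun t => ?_⟩
    have e : ((x + y : ℤ) : ℝ) * t / 2 = x * t / 2 + y * t / 2 := by push_cast; ring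
    rw [e, Real.sin_add]
    have a1 := h1 t
    have a2 := h2 t
    set A := Real.sin (x * t / 2)
    set B := Real.sin (y * t / 2)
    have c1 := Real.sin_sq_add_cos_sq (x * t / 2)
    have c2 := Real.sin_sq_add_cos_sq (y * t / 2)
    set c := Real.cos (x * t / 2)
    set c' := Real.cos (y * t / 2)
    have : (A * c' + c * B) ^ 2 ≤ 2 * (A ^ 2 * c' ^ 2 + c ^ 2 * B ^ 2) := by
      nlinarith [sq_nonneg (A * c' - c * B)]
    have h3 : A ^ 2 * c' ^ 2 ≤ A ^ 2 := by nlinarith [sq_nonneg A, sq_nonneg B]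
    have h4 : c ^ 2 * B ^ 2 ≤ B ^ 2 := by nlinarith [sq_nonneg A, sq_nonneg B]
    linarith
  | neg x _ hx =>
    obtain ⟨K, hK, h1⟩ := hx
    refine ⟨K, hK, fun t => ?_⟩
    have e : ((-x : ℤ) : ℝ) * t / 2 = -(x * t / 2) := by push_cast; ring
    rw [e, Real.sin_neg, neg_sq]
    exact h1 t

/-- Gaussian decay of the characteristic function over a period, where `d` is the span. -/
theorem exists_span_decay (hr : IsCriticalLaw r v) :
    ∃ d : ℕ, 0 < d ∧ (∀ j, r j ≠ 0 → d ∣ j) ∧ ∃ c : ℝ, 0 < c ∧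
    ∀ t, |t| ≤ Real.pi / d → ‖circleSum (PowerSeries.mk r) t‖ ≤ Real.exp (-c * t ^ 2) := by
  set S : Set ℤ := {x : ℤ | ∃ j : ℕ, r j ≠ 0 ∧ x = j} with hS
  obtain ⟨a, ha⟩ := Int.subgroup_cyclic (AddSubgroup.closure S)
  have hdvd : ∀ j, r j ≠ 0 → a.natAbs ∣ j := by
    intro j hj
    have hmem : (j : ℤ) ∈ AddSubgroup.closure S := AddSubgroup.subset_closure ⟨j, hj, rfl⟩
    rw [ha, AddSubgroup.mem_closure_singleton] at hmem
    obtain ⟨k, hk⟩ := hmem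
    exact Int.natAbs_dvd_natAbs.mpr (show a ∣ (j : ℤ) from ⟨k, by rw [← hk]; simp [mul_comm]⟩)
  obtain ⟨j, hj2, hj⟩ := hr.exists_two_le
  have hd : 0 < a.natAbs := by
    rcases Nat.eq_zero_or_pos a.natAbs with h | h
    · have := hdvd j hj.ne'
      rw [h, zero_dvd_iff] at this
      lia
    · exact h
  obtain ⟨K, hK, hsin⟩ := hr.exists_sin_sq_le (x := a) <| by
    rw [← hS, ha]
    exact AddSubgroup.subset_closure rfl
  have h0 := hr.zero_pos
  set d := a.natAbs with hda
  have hd' : (0 : ℝ) < d := by exact_mod_cast hd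
  have hpi := Real.pi_pos
  refine ⟨d, hd, hdvd, r 0 * d ^ 2 / (Real.pi ^ 2 * (K + 1)), by positivity, fun t ht => ?_⟩
  have hjordan : (d * |t| / Real.pi) ^ 2 ≤ Real.sin (a * t / 2) ^ 2 := by
    have hsq : Real.sin (a * t / 2) ^ 2 = Real.sin (d * |t| / 2) ^ 2 := by
      rcases abs_choice t with h | h <;> rcases Int.natAbs_eq a with h' | h' <;>
        rw [h, h', ← hda] <;> push_cast <;>
        simp only [neg_mul, mul_neg, neg_div, Real.sin_neg, neg_sq]
    rw [hsq]
    have h := Real.mul_le_sin (x := d * |t| / 2) (by positivity) (by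
      rw [le_div_iff₀ hd'] at ht
      linarith)
    refine pow_le_pow_left₀ (by positivity) (le_trans (le_of_eq ?_) h) 2
    field_simp
  have hV : r 0 * d ^ 2 / (Real.pi ^ 2 * (K + 1)) * t ^ 2 ≤
      r 0 * (1 - (circleSum (PowerSeries.mk r) t).re) := by
    have h1 := hjordan.trans (hsin t)
    have hnn : 0 ≤ 1 - (circleSum (PowerSeries.mk r) t).re :=
      (hr.hasSum_one_sub_cos t).nonneg fun j =>
        mul_nonneg (hr.nonneg j) (by linarith [Real.cos_le_one (j * t)])
    rw [div_pow, mul_pow, sq_abs, div_le_iff₀ (by positivity)] at h1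
    rw [div_mul_eq_mul_div, div_le_iff₀ (by positivity), mul_assoc, mul_assoc]
    refine mul_le_mul_of_nonneg_left (h1.trans ?_) h0.le
    nlinarith [sq_nonneg Real.pi, mul_nonneg hnn (sq_nonneg Real.pi)]
  refine abs_le_of_sq_le_sq' ?_ (Real.exp_pos _).le |>.2
  rw [← Real.exp_nat_mul]
  refine (hr.norm_sq_circleSum_le t).trans (le_trans ?_ (Real.add_one_le_exp _))
  push_cast
  linarith

end IsCriticalLaw

theorem abs_mul_exp_neg_mul_sq_le {b : ℝ} (hb : 0 < b) (t : ℝ) :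
    |t| * Real.exp (-b * t ^ 2) ≤ 1 / √b * Real.exp (-(b / 2) * t ^ 2) := by
  have hsb := Real.sqrt_pos.mpr hb
  have h : √b * |t| ≤ Real.exp (b / 2 * t ^ 2) := by
    refine le_trans ?_ (Real.add_one_le_exp _)
    have e : b / 2 * t ^ 2 = (√b * |t|) ^ 2 / 2 := by
      rw [mul_pow, Real.sq_sqrt hb.le, sq_abs]; ring
    rw [e]
    nlinarith [sq_nonneg (√b * |t| - 1)]
  rw [show -b * t ^ 2 = -(b / 2 * t ^ 2) + -(b / 2) * t ^ 2 by ring, Real.exp_add, ← mul_assoc]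
  refine mul_le_mul_of_nonneg_right ?_ (Real.exp_pos _).le
  rw [Real.exp_neg, ← div_eq_mul_inv, div_le_div_iff₀ (Real.exp_pos _) hsb]
  linarith

theorem norm_exp_mul_I_sub_one_sub_le (x : ℝ) :
    ‖Complex.exp (x * Complex.I) - 1 - x * Complex.I‖ ≤ 3 * x ^ 2 := by
  have hx : ‖(x : ℂ) * Complex.I‖ = |x| := by simp
  rcases le_total |x| 1 with h | h
  · refine (Complex.norm_exp_sub_one_sub_id_le (hx.trans_le h)).trans ?_
    rw [hx, sq_abs]
    nlinarith [sq_nonneg x]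
  · refine (norm_sub_le _ _).trans ?_
    have h1 : ‖Complex.exp (x * Complex.I) - 1‖ ≤ |x| := by
      simpa [mul_comm] using Real.norm_exp_I_mul_ofReal_sub_one_le (x := x)
    rw [hx, ← sq_abs x]
    nlinarith

theorem tendsto_mul_exp_sub_one_sub (y : ℝ) :
    Tendsto (fun n : ℕ => (n : ℂ) * (Complex.exp ((y / √n : ℝ) * Complex.I) - 1 -
      (y / √n : ℝ) * Complex.I)) atTop (nhds (-(y ^ 2 / 2 : ℝ))) := by
  have hs : Tendsto (fun n : ℕ => √(n : ℝ)) atTop atTop :=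
    Real.tendsto_sqrt_atTop.comp tendsto_natCast_atTop_atTop
  rw [tendsto_iff_norm_sub_tendsto_zero]
  refine squeeze_zero' (Eventually.of_forall fun n => norm_nonneg _) ?_
    (hs.const_div_atTop (|y| ^ 3))
  filter_upwards [hs.eventually_ge_atTop |y|, eventually_ge_atTop 1] with n hn h1
  have hn0 : (0 : ℝ) < n := by exact_mod_cast h1
  have hsn : 0 < √(n : ℝ) := Real.sqrt_pos.mpr hn0
  set z : ℂ := (y / √n : ℝ) * Complex.I with hz
  have hzn : ‖z‖ = |y| / √n := by
    rw [hz, norm_mul, Complex.norm_I, mul_one, Complex.norm_real, Real.norm_eq_abs, abs_div,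
      abs_of_pos hsn]
  have hz1 : ‖z‖ ≤ 1 := by rw [hzn, div_le_one hsn]; exact hn
  have hb := Complex.exp_bound hz1 (n := 3) (by norm_num)
  have hz2 : (n : ℂ) * z ^ 2 = -(y ^ 2 : ℝ) := by
    rw [hz, mul_pow, Complex.I_sq, ← Complex.ofReal_pow, div_pow, Real.sq_sqrt hn0.le]
    have : (n : ℂ) ≠ 0 := by exact_mod_cast hn0.ne'
    push_cast
    field_simp
  have e : (n : ℂ) * (Complex.exp z - 1 - z) - -(y ^ 2 / 2 : ℝ) =
      n * (Complex.exp z - ∑ m ∈ Finset.range 3, z ^ m / m.factorial) := by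
    simp only [Finset.sum_range_succ, Finset.sum_range_zero, Nat.factorial]
    push_cast at hz2 ⊢
    linear_combination (1 / 2 : ℂ) * hz2
  rw [e, norm_mul, Complex.norm_natCast]
  calc (n : ℝ) * _ ≤ n * (‖z‖ ^ 3 * 1) := by
        refine mul_le_mul_of_nonneg_left (hb.trans ?_) hn0.le
        refine mul_le_mul_of_nonneg_left ?_ (by positivity)
        norm_num [Nat.factorial]
    _ = |y| ^ 3 / √n := by
        rw [hzn, div_pow]
        have := Real.sq_sqrt hn0.le
        field_simp
        linear_combination -|y| ^ 3 * this

theorem coeff_mk_pow_nonneg {r : ℕ → ℝ} (hr : ∀ j, 0 ≤ r j) (N s : ℕ) :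
    0 ≤ coeff s (PowerSeries.mk r ^ N) := by
  induction N generalizing s with
  | zero => rw [pow_zero, coeff_one]; split_ifs <;> norm_num
  | succ N ih =>
    rw [pow_succ, coeff_mul]
    exact Finset.sum_nonneg fun x _ => mul_nonneg (ih _) (by simpa using hr _)

theorem sub_mul_coeff_mk_pow (r : ℕ → ℝ) (N s : ℕ) :
    ((N : ℝ) + 1 - s) * coeff s (PowerSeries.mk r ^ (N + 1)) = ((N : ℝ) + 1) *
      coeff s ((PowerSeries.mk fun j : ℕ => (1 - (j : ℝ)) * r j) * PowerSeries.mk r ^ N) := by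
  rw [sub_mul, natCast_mul_coeff_pow, ← mul_sub, pow_succ', coeff_mul, coeff_mul,
    ← Finset.sum_sub_distrib]
  congr 1
  refine Finset.sum_congr rfl fun x _ => ?_
  simp only [coeff_mk]
  ring

namespace IsCriticalLaw

variable {r : ℕ → ℝ} {v : ℝ}

theorem coeff_pow_nonneg (hr : IsCriticalLaw r v) (N s : ℕ) : 0 ≤ coeff s (PowerSeries.mk r ^ N) :=
  coeff_mk_pow_nonneg hr.nonneg N s

theorem exists_coeff_pow_le (hr : IsCriticalLaw r v) : ∃ C : ℝ, 0 < C ∧ ∀ N : ℕ, 1 ≤ N → ∀ s,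
    coeff s (PowerSeries.mk r ^ N) ≤ C / √N := by
  obtain ⟨d, hd, hdvd, c, hc, hdecay⟩ := hr.exists_span_decay
  have hd' : (0 : ℝ) < d := by exact_mod_cast hd
  have hsc := Real.sqrt_pos.mpr hc
  refine ⟨d / √c, by positivity, fun N hN s => ?_⟩
  have hN' : (0 : ℝ) < N := by exact_mod_cast hN
  have h := abs_coeff_le_of_norm_circleSum_le (summable_abs_coeff_pow hr.summable_abs N) hd
    (dvd_of_coeff_pow_ne_zero (by simpa using hdvd) N) zero_le_one (b := c * N) (by positivity)
    (fun t ht => by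
      rw [circleSum_pow hr.summable_abs, norm_pow, one_mul]
      refine (pow_le_pow_left₀ (norm_nonneg _) (hdecay t ht) N).trans_eq ?_
      rw [← Real.exp_nat_mul]
      ring_nf) s
  refine (le_abs_self _).trans (h.trans_eq ?_)
  rw [Real.sqrt_mul hc.le, mul_one, div_div]

theorem summable_abs_centered (hr : IsCriticalLaw r v) :
    Summable fun j => |coeff j (PowerSeries.mk fun j : ℕ => (1 - (j : ℝ)) * r j)| := by
  refine Summable.of_nonneg_of_le (fun _ => abs_nonneg _) (fun j => ?_)
    (hr.hasSum_one.summable.add hr.hasSum_mean.summable)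
  rw [coeff_mk, abs_mul, abs_of_nonneg (hr.nonneg j), ← one_add_mul]
  refine mul_le_mul_of_nonneg_right ?_ (hr.nonneg j)
  have : (0 : ℝ) ≤ j := j.cast_nonneg
  rw [abs_le]
  constructor <;> linarith

theorem norm_circleSum_centered_le (hr : IsCriticalLaw r v) (t : ℝ) :
    ‖circleSum (PowerSeries.mk fun j : ℕ => (1 - (j : ℝ)) * r j) t‖ ≤ v * |t| := by
  have h1 := hasSum_circleSum hr.summable_abs_centered t
  have h2 := (Complex.hasSum_ofReal.mpr hr.hasSum_centered).mul_right
    (Complex.exp (t * Complex.I))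
  have h3 := h1.add h2
  rw [Complex.ofReal_zero, zero_mul, add_zero] at h3
  refine h3.norm_le_of_bounded (hr.hasSum_variance.mul_right |t|) fun j => ?_
  rw [coeff_mk]
  have e : ((((1 - (j : ℝ)) * r j : ℝ)) : ℂ) * Complex.exp ((j * t : ℝ) * Complex.I) +
      ((((j : ℝ) - 1) * r j : ℝ) : ℂ) * Complex.exp (t * Complex.I) =
      ((1 - (j : ℝ)) * r j : ℝ) * Complex.exp (t * Complex.I) *
        (Complex.exp (Complex.I * ((((j : ℝ) - 1) * t : ℝ) : ℂ)) - 1) := by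
    have : Complex.exp ((j * t : ℝ) * Complex.I) = Complex.exp (t * Complex.I) *
        Complex.exp (Complex.I * ((((j : ℝ) - 1) * t : ℝ) : ℂ)) := by
      rw [← Complex.exp_add]
      push_cast
      ring_nf
    rw [this]
    push_cast
    ring
  rw [e, norm_mul, norm_mul, Complex.norm_exp_ofReal_mul_I, mul_one, Complex.norm_real,
    Real.norm_eq_abs, abs_mul, abs_of_nonneg (hr.nonneg j)]
  have h4 := Real.norm_exp_I_mul_ofReal_sub_one_le (x := ((j : ℝ) - 1) * t)
  rw [Real.norm_eq_abs, abs_mul] at h4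
  calc |1 - (j : ℝ)| * r j * _ ≤ |1 - (j : ℝ)| * r j * (|(j : ℝ) - 1| * |t|) :=
        mul_le_mul_of_nonneg_left h4 (mul_nonneg (abs_nonneg _) (hr.nonneg j))
    _ = r j * ((j : ℝ) - 1) ^ 2 * |t| := by rw [abs_sub_comm, ← sq_abs ((j : ℝ) - 1)]; ring

theorem exists_abs_sub_mul_coeff_pow_le (hr : IsCriticalLaw r v) :
    ∃ C : ℝ, 0 < C ∧ ∀ N : ℕ, 1 ≤ N → ∀ s : ℕ,
    |((N : ℝ) - s) * coeff s (PowerSeries.mk r ^ N)| ≤ C := by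
  obtain ⟨d, hd, hdvd, c, hc, hdecay⟩ := hr.exists_span_decay
  have hd' : (1 : ℝ) ≤ d := by exact_mod_cast hd
  have hv := hr.variance_pos
  refine ⟨d * (v * Real.exp (c * Real.pi ^ 2)) * √2 / c, by positivity, fun N hN s => ?_⟩
  obtain ⟨N, rfl⟩ := Nat.exists_eq_add_of_le' hN
  have hb : 0 < c * ((N : ℝ) + 1) := by positivity
  have hdG : ∀ j, coeff j (PowerSeries.mk fun j : ℕ => (1 - (j : ℝ)) * r j) ≠ 0 → d ∣ j := by
    intro j hj
    rw [coeff_mk] at hj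
    exact hdvd j (right_ne_zero_of_mul hj)
  have h := abs_coeff_le_of_norm_circleSum_le
    (summable_abs_coeff_mul hr.summable_abs_centered (summable_abs_coeff_pow hr.summable_abs N)) hd
    (dvd_of_coeff_mul_ne_zero hdG (dvd_of_coeff_pow_ne_zero (by simpa using hdvd) N))
    (M := v * Real.exp (c * Real.pi ^ 2) * (1 / √(c * ((N : ℝ) + 1))))
    (b := c * ((N : ℝ) + 1) / 2) (by positivity) (by positivity)
    (fun t ht => by
      rw [circleSum_mul hr.summable_abs_centered (summable_abs_coeff_pow hr.summable_abs N),
        circleSum_pow hr.summable_abs, norm_mul, norm_pow]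
      have h1 : ‖circleSum (PowerSeries.mk r) t‖ ^ N ≤
          Real.exp (c * Real.pi ^ 2) * Real.exp (-(c * ((N : ℝ) + 1)) * t ^ 2) := by
        refine (pow_le_pow_left₀ (norm_nonneg _) (hdecay t ht) N).trans ?_
        rw [← Real.exp_nat_mul, ← Real.exp_add, Real.exp_le_exp]
        have ht' : |t| ≤ Real.pi := ht.trans (div_le_self Real.pi_pos.le hd')
        have ht2 : t ^ 2 ≤ Real.pi ^ 2 := by
          rw [← sq_abs t]
          exact pow_le_pow_left₀ (abs_nonneg t) ht' 2
        nlinarith [mul_le_mul_of_nonneg_left ht2 hc.le]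
      calc _ ≤ v * |t| * (Real.exp (c * Real.pi ^ 2) *
              Real.exp (-(c * ((N : ℝ) + 1)) * t ^ 2)) :=
            mul_le_mul (hr.norm_circleSum_centered_le t) h1 (by positivity) (by positivity)
        _ = v * Real.exp (c * Real.pi ^ 2) *
              (|t| * Real.exp (-(c * ((N : ℝ) + 1)) * t ^ 2)) := by ring
        _ ≤ v * Real.exp (c * Real.pi ^ 2) * (1 / √(c * ((N : ℝ) + 1)) *
              Real.exp (-(c * ((N : ℝ) + 1) / 2) * t ^ 2)) :=
            mul_le_mul_of_nonneg_left (abs_mul_exp_neg_mul_sq_le hb t) (by positivity)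
        _ = _ := by ring) s
  push_cast
  rw [sub_mul_coeff_mk_pow, abs_mul, abs_of_pos (by positivity)]
  refine (mul_le_mul_of_nonneg_left h (by positivity)).trans_eq ?_
  have hsq := Real.sq_sqrt hb.le
  have hsb := Real.sqrt_pos.mpr hb
  rw [Real.sqrt_div hb.le]
  generalize √(c * ((N : ℝ) + 1)) = w at *
  have hN1 : (N : ℝ) + 1 = w ^ 2 / c := by rw [hsq]; field_simp
  rw [hN1]
  field_simp

theorem tendsto_circleSum_pow (hr : IsCriticalLaw r v) (y : ℝ) :
    Tendsto (fun n : ℕ => (circleSum (PowerSeries.mk r) (y / √n) *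
      Complex.exp (-(y / √n : ℝ) * Complex.I)) ^ n) atTop
      (nhds ((Real.exp (-(v / 2) * y ^ 2) : ℝ) : ℂ)) := by
  have hsum : ∀ u : ℝ, HasSum (fun j : ℕ => (r j : ℂ) *
      (Complex.exp (((((j : ℝ) - 1) * u : ℝ) : ℂ) * Complex.I) - 1 -
        ((((j : ℝ) - 1) * u : ℝ) : ℂ) * Complex.I))
      (circleSum (PowerSeries.mk r) u * Complex.exp (-(u : ℝ) * Complex.I) - 1) := by
    intro u
    have h1 := (hasSum_circleSum hr.summable_abs u).mul_right (Complex.exp (-(u : ℝ) * Complex.I))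
    have h2 := Complex.hasSum_ofReal.mpr hr.hasSum_one
    have h3 := (Complex.hasSum_ofReal.mpr hr.hasSum_centered).mul_right (u * Complex.I)
    have h4 := (h1.sub h2).sub h3
    rw [Complex.ofReal_zero, zero_mul, sub_zero, Complex.ofReal_one] at h4
    refine h4.congr_fun fun j => ?_
    rw [coeff_mk]
    have : Complex.exp (((((j : ℝ) - 1) * u : ℝ) : ℂ) * Complex.I) =
        Complex.exp ((j * u : ℝ) * Complex.I) * Complex.exp (-(u : ℝ) * Complex.I) := by
      rw [← Complex.exp_add]
      push_cast
      ring_nf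
    rw [this]
    push_cast
    ring
  have key : Tendsto (fun n : ℕ => (n : ℂ) * (circleSum (PowerSeries.mk r) (y / √n) *
      Complex.exp (-(y / √n : ℝ) * Complex.I) - 1)) atTop (nhds ((-(v / 2) * y ^ 2 : ℝ) : ℂ)) := by
    have hlim := tendsto_tsum_of_dominated_convergence (𝓕 := atTop)
      (f := fun (n j : ℕ) => (n : ℂ) * ((r j : ℂ) *
        (Complex.exp (((((j : ℝ) - 1) * (y / √n) : ℝ) : ℂ) * Complex.I) - 1 -
        ((((j : ℝ) - 1) * (y / √n) : ℝ) : ℂ) * Complex.I)))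
      (g := fun j : ℕ => ((r j * (-((((j : ℝ) - 1) * y) ^ 2 / 2)) : ℝ) : ℂ))
      (bound := fun j : ℕ => r j * ((j : ℝ) - 1) ^ 2 * (3 * y ^ 2))
      (hr.hasSum_variance.mul_right _).summable
      (fun j => by
        have h := (tendsto_mul_exp_sub_one_sub (((j : ℝ) - 1) * y)).const_mul (r j : ℂ)
        push_cast at h ⊢
        refine h.congr fun n => ?_
        rw [mul_div_assoc]
        ring)
      (by
        filter_upwards [eventually_ge_atTop 1] with n hn j
        have hn0 : (0 : ℝ) < n := by exact_mod_cast hn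
        rw [norm_mul, norm_mul, Complex.norm_natCast, Complex.norm_real, Real.norm_eq_abs,
          abs_of_nonneg (hr.nonneg j)]
        have h := norm_exp_mul_I_sub_one_sub_le (((j : ℝ) - 1) * (y / √n))
        calc _ ≤ (n : ℝ) * (r j * (3 * (((j : ℝ) - 1) * (y / √n)) ^ 2)) :=
              mul_le_mul_of_nonneg_left (mul_le_mul_of_nonneg_left h (hr.nonneg j)) hn0.le
          _ = _ := by
              rw [mul_pow, div_pow, Real.sq_sqrt hn0.le]
              field_simp)
    have hval : ∑' j : ℕ, ((r j * (-((((j : ℝ) - 1) * y) ^ 2 / 2)) : ℝ) : ℂ) =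
        ((-(v / 2) * y ^ 2 : ℝ) : ℂ) := by
      refine HasSum.tsum_eq (Complex.hasSum_ofReal.mpr ?_)
      convert! hr.hasSum_variance.mul_right (-(y ^ 2) / 2) using 1
      · ext j; ring
      · ring
    rw [hval] at hlim
    refine hlim.congr fun n => ?_
    exact ((hsum (y / √n)).mul_left (n : ℂ)).tsum_eq
  have h := Complex.tendsto_one_add_pow_exp_of_tendsto key
  rw [Complex.ofReal_exp]
  refine h.congr fun n => ?_
  rw [add_sub_cancel]

/-- The local limit theorem near the mean, before Fourier inversion. -/
theorem tendsto_sqrt_mul_integral (hr : IsCriticalLaw r v) {d : ℕ} (hd : 0 < d) {c : ℝ}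
    (hc : 0 < c) (hdecay : ∀ t, |t| ≤ Real.pi / d →
      ‖circleSum (PowerSeries.mk r) t‖ ≤ Real.exp (-c * t ^ 2)) :
    Tendsto (fun n : ℕ => (√n : ℂ) * ∫ t in (-(Real.pi / d))..(Real.pi / d),
      circleSum (PowerSeries.mk r ^ n) t * Complex.exp (-((n - 1 : ℕ) * t : ℝ) * Complex.I))
      atTop (nhds ((√(Real.pi / (v / 2)) : ℝ) : ℂ)) := by
  have hd' : (0 : ℝ) < d := by exact_mod_cast hd
  have hpi : 0 < Real.pi / d := by positivity
  set h : ℕ → ℝ → ℂ := fun n t => circleSum (PowerSeries.mk r ^ n) t *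
    Complex.exp (-((n - 1 : ℕ) * t : ℝ) * Complex.I) with hh
  have hcont : ∀ n, Continuous (h n) := fun n =>
    (continuous_circleSum (summable_abs_coeff_pow hr.summable_abs n)).mul (by fun_prop)
  have hnorm : ∀ n t, ‖h n t‖ = ‖circleSum (PowerSeries.mk r) t‖ ^ n := by
    intro n t
    rw [hh, norm_mul, ← Complex.ofReal_neg, Complex.norm_exp_ofReal_mul_I, mul_one,
      circleSum_pow hr.summable_abs, norm_pow]
  have hmem : ∀ (n : ℕ) (x : ℝ), x ∈ Ioc (-(Real.pi / d) * √n) (Real.pi / d * √n) →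
      0 < √(n : ℝ) ∧ |x / √n| ≤ Real.pi / d := by
    intro n x hx
    have hpos : 0 < √(n : ℝ) := by
      rcases (Real.sqrt_nonneg (n : ℝ)).eq_or_lt with h0 | h0
      · rw [← h0] at hx
        simp at hx
      · exact h0
    refine ⟨hpos, ?_⟩
    rw [abs_div, abs_of_pos hpos, div_le_iff₀ hpos, abs_le]
    exact ⟨by linarith [hx.1], hx.2⟩
  have hlim := MeasureTheory.tendsto_integral_of_dominated_convergence
    (μ := MeasureTheory.volume)
    (F := fun n => (Ioc (-(Real.pi / d) * √n) (Real.pi / d * √n)).indicator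
      fun x => h n (x / √n))
    (f := fun x => ((Real.exp (-(v / 2) * x ^ 2) : ℝ) : ℂ))
    (fun x => Real.exp (-c * x ^ 2))
    (fun n => ((hcont n).comp (by fun_prop)).aestronglyMeasurable.indicator measurableSet_Ioc)
    (integrable_exp_neg_mul_sq hc)
    (fun n => MeasureTheory.ae_of_all _ fun x => by
      by_cases hx : x ∈ Ioc (-(Real.pi / d) * √n) (Real.pi / d * √n)
      · obtain ⟨hpos, habs⟩ := hmem n x hx
        rw [indicator_of_mem hx, hnorm]
        refine (pow_le_pow_left₀ (norm_nonneg _) (hdecay _ habs) n).trans_eq ?_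
        have hn0 : (0 : ℝ) < n := Real.sqrt_pos.mp hpos
        rw [← Real.exp_nat_mul, div_pow, Real.sq_sqrt hn0.le]
        congr 1
        field_simp
      · rw [indicator_of_notMem hx, norm_zero]
        positivity)
    (MeasureTheory.ae_of_all _ fun x => by
      have hs : Tendsto (fun n : ℕ => √(n : ℝ)) atTop atTop :=
        Real.tendsto_sqrt_atTop.comp tendsto_natCast_atTop_atTop
      have h0 : Tendsto (fun n : ℕ => Complex.exp ((x / √n : ℝ) * Complex.I)) atTop (nhds 1) := by
        have hz : Tendsto (fun n : ℕ => x / √(n : ℝ)) atTop (nhds 0) := hs.const_div_atTop x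
        have hcts : Continuous fun u : ℝ => Complex.exp (u * Complex.I) := by fun_prop
        have h := (hcts.tendsto 0).comp hz
        simp only [Complex.ofReal_zero, zero_mul, Complex.exp_zero] at h
        exact h
      have h1 := (hr.tendsto_circleSum_pow x).mul h0
      rw [mul_one] at h1
      refine h1.congr' ?_
      have hs' : Tendsto (fun n : ℕ => Real.pi / d * √(n : ℝ)) atTop atTop :=
        hs.const_mul_atTop hpi
      filter_upwards [hs'.eventually_gt_atTop |x|, eventually_ge_atTop 1] with n hn hn1
      rw [indicator_of_mem (show x ∈ Ioc (-(Real.pi / d) * √n) (Real.pi / d * √n) from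
        ⟨by linarith [(abs_lt.mp hn).1], (abs_lt.mp hn).2.le⟩)]
      simp only [hh]
      rw [circleSum_pow hr.summable_abs, mul_pow, mul_assoc, ← Complex.exp_nat_mul,
        ← Complex.exp_add]
      congr 2
      push_cast [hn1]
      ring)
  rw [integral_complex_ofReal, integral_gaussian] at hlim
  refine hlim.congr' ?_
  filter_upwards [eventually_ge_atTop 1] with n hn
  have hpos : 0 < √(n : ℝ) := Real.sqrt_pos.mpr (by exact_mod_cast hn)
  rw [MeasureTheory.integral_indicator measurableSet_Ioc, ← intervalIntegral.integral_of_le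
    (by nlinarith), intervalIntegral.integral_comp_div _ hpos.ne', mul_div_cancel_right₀ _ hpos.ne',
    mul_div_cancel_right₀ _ hpos.ne', Complex.real_smul]

theorem exists_le_coeff_pow (hr : IsCriticalLaw r v) : ∃ c : ℝ, 0 < c ∧ ∀ n, 1 ≤ n →
    coeff (n - 1) (PowerSeries.mk r ^ n) ≠ 0 → c / √n ≤ coeff (n - 1) (PowerSeries.mk r ^ n) := by
  obtain ⟨d, hd, hdvd, c, hc, hdecay⟩ := hr.exists_span_decay
  have hd' : (0 : ℝ) < d := by exact_mod_cast hd
  have hv := hr.variance_pos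
  have hpi := Real.pi_pos
  have hlim := (hr.tendsto_sqrt_mul_integral hd hc hdecay).norm
  set L := √(Real.pi / (v / 2)) with hL
  have hLpos : 0 < L := Real.sqrt_pos.mpr (by positivity)
  rw [Complex.norm_real, Real.norm_eq_abs, abs_of_pos hLpos] at hlim
  obtain ⟨n₀, hn₀⟩ := eventually_atTop.mp (hlim.eventually_const_lt (half_lt_self hLpos))
  have hlarge : ∀ n, n₀ ≤ n → 1 ≤ n → coeff (n - 1) (PowerSeries.mk r ^ n) ≠ 0 →
      L / 2 * (d / (2 * Real.pi)) / √n ≤ coeff (n - 1) (PowerSeries.mk r ^ n) := by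
    intro n hn hn1 hne
    have hF : ∀ j, coeff j (PowerSeries.mk r ^ n) ≠ 0 → d ∣ j :=
      dvd_of_coeff_pow_ne_zero (by simpa using hdvd) n
    have h := hn₀ n hn
    rw [coeff_eq_integral_circleSum (summable_abs_coeff_pow hr.summable_abs n) hd hF
      (hF _ hne), norm_mul, norm_mul, Complex.norm_real, Complex.norm_real, Complex.norm_real,
      Real.norm_eq_abs, Real.norm_eq_abs, Real.norm_eq_abs, abs_of_nonneg (Real.sqrt_nonneg _),
      abs_of_pos (by positivity), abs_of_nonneg (hr.coeff_pow_nonneg _ _)] at h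
    have hpos : 0 < √(n : ℝ) := Real.sqrt_pos.mpr (by exact_mod_cast hn1)
    rw [div_le_iff₀ hpos, mul_div_assoc', div_le_iff₀ (by positivity)]
    have e : √(n : ℝ) * (2 * Real.pi / d * coeff (n - 1) (PowerSeries.mk r ^ n)) * d =
      coeff (n - 1) (PowerSeries.mk r ^ n) * √n * (2 * Real.pi) := by field_simp
    nlinarith [mul_le_mul_of_nonneg_right h.le hd'.le]
  have hsmall : ∀ m, ∃ c : ℝ, 0 < c ∧ ∀ n, n < m → 1 ≤ n →
      coeff (n - 1) (PowerSeries.mk r ^ n) ≠ 0 →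
      c / √n ≤ coeff (n - 1) (PowerSeries.mk r ^ n) := by
    intro m
    induction m with
    | zero => exact ⟨1, one_pos, fun n hn => absurd hn n.not_lt_zero⟩
    | succ m ih =>
      obtain ⟨c, hc, h⟩ := ih
      by_cases hm : coeff (m - 1) (PowerSeries.mk r ^ m) = 0
      · refine ⟨c, hc, fun n hn hn1 hne => h n ?_ hn1 hne⟩
        rcases Nat.lt_succ_iff_lt_or_eq.mp hn with h1 | rfl
        · exact h1
        · exact absurd hm hne
      · have hmpos := (hr.coeff_pow_nonneg m (m - 1)).lt_of_ne' hm
        refine ⟨min c (coeff (m - 1) (PowerSeries.mk r ^ m)), lt_min hc hmpos,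
          fun n hn hn1 hne => ?_⟩
        have hs1 : 1 ≤ √(n : ℝ) := Real.one_le_sqrt.mpr (by exact_mod_cast hn1)
        rcases Nat.lt_succ_iff_lt_or_eq.mp hn with h1 | rfl
        · exact (div_le_div_of_nonneg_right (min_le_left _ _) (by positivity)).trans
            (h n h1 hn1 hne)
        · exact (div_le_self (lt_min hc hmpos).le hs1).trans (min_le_right _ _)
  obtain ⟨c', hc', hc'le⟩ := hsmall n₀
  refine ⟨min (L / 2 * (d / (2 * Real.pi))) c', lt_min (by positivity) hc',
    fun n hn hne => ?_⟩
  rcases lt_or_ge n n₀ with h | h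
  · exact (div_le_div_of_nonneg_right (min_le_right _ _) (Real.sqrt_nonneg _)).trans
      (hc'le n h hn hne)
  · exact (div_le_div_of_nonneg_right (min_le_left _ _) (Real.sqrt_nonneg _)).trans
      (hlarge n h hn hne)

end IsCriticalLaw

theorem spineOp_mono (p : ℕ → ℝ≥0∞) : Monotone (spineOp p) := fun _ _ h _ =>
  ENNReal.tsum_le_tsum fun _ => mul_le_mul_right (h _) _

section SpineOp

variable {p : ℕ → ℝ≥0∞}

theorem tsum_siblingLaw (hmean : ∑' k : ℕ, (k : ℝ≥0∞) * p k = 1) : ∑' m, siblingLaw p m = 1 := by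
  rw [tsum_eq_zero_add' ENNReal.summable] at hmean
  simpa [siblingLaw] using hmean

theorem tsum_mul_siblingLaw_ne_top (hmean : ∑' k : ℕ, (k : ℝ≥0∞) * p k = 1)
    (hvar_fin : xiVar p ≠ ⊤) : ∑' m : ℕ, (m : ℝ≥0∞) * siblingLaw p m ≠ ⊤ := by
  refine ne_top_of_le_ne_top (ENNReal.add_ne_top.mpr ⟨hvar_fin, ENNReal.one_ne_top⟩)
    (b := xiVar p + 1) ?_
  rw [← tsum_siblingLaw hmean, xiVar,
    tsum_eq_zero_add' (f := fun k => p k * _) ENNReal.summable, add_assoc,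
    ← ENNReal.tsum_add]
  refine le_add_left (ENNReal.tsum_le_tsum fun m => ?_)
  have h : ENNReal.ofReal ((((m + 1 : ℕ) : ℝ) - 1) ^ 2) = (m : ℝ≥0∞) ^ 2 := by
    rw [Nat.cast_succ, add_sub_cancel_right, ENNReal.ofReal_pow m.cast_nonneg,
      ENNReal.ofReal_natCast]
  rw [h, siblingLaw]
  calc (m : ℝ≥0∞) * ((m + 1) * p (m + 1)) ≤ m * ((m + 1) * p (m + 1)) + p (m + 1) := le_self_add
    _ = _ := by ring

theorem iterate_spineOp_const (hmean : ∑' k : ℕ, (k : ℝ≥0∞) * p k = 1) (a : ℝ≥0∞) (k : ℕ) :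
    (spineOp p)^[k] (fun _ => a) = fun _ => a := by
  refine Function.iterate_fixed ?_ k
  ext l
  rw [spineOp, ENNReal.tsum_mul_right, tsum_siblingLaw hmean, one_mul]

theorem iterate_spineOp_linear (hmean : ∑' k : ℕ, (k : ℝ≥0∞) * p k = 1) (a : ℝ≥0∞) (k : ℕ) :
    (spineOp p)^[k] (fun l => a * l) =
      fun l : ℕ => a * (l + k * ∑' m : ℕ, (m : ℝ≥0∞) * siblingLaw p m) := by
  induction k with
  | zero => ext l; simp
  | succ k ih =>
    rw [Function.iterate_succ_apply', ih]
    ext l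
    have h : ∀ m : ℕ, siblingLaw p m *
        (a * (((m + l : ℕ) : ℝ≥0∞) + k * ∑' m : ℕ, (m : ℝ≥0∞) * siblingLaw p m)) =
        a * (m * siblingLaw p m) +
          siblingLaw p m * (a * (l + k * ∑' m : ℕ, (m : ℝ≥0∞) * siblingLaw p m)) := by
      intro m
      push_cast
      ring
    rw [spineOp, tsum_congr h, ENNReal.tsum_add, ENNReal.tsum_mul_left, ENNReal.tsum_mul_right,
      tsum_siblingLaw hmean]
    push_cast
    ring

theorem iterate_spineOp_geometric (p : ℕ → ℝ≥0∞) (a x : ℝ≥0∞) (k : ℕ) :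
    (spineOp p)^[k] (fun l => a * x ^ l) =
      fun l => a * (∑' m, siblingLaw p m * x ^ m) ^ k * x ^ l := by
  induction k with
  | zero => ext l; simp
  | succ k ih =>
    rw [Function.iterate_succ_apply', ih]
    ext l
    have h : ∀ m, siblingLaw p m * (a * (∑' m, siblingLaw p m * x ^ m) ^ k * x ^ (m + l)) =
        siblingLaw p m * x ^ m * (a * (∑' m, siblingLaw p m * x ^ m) ^ k * x ^ l) := by
      intro m
      ring
    rw [spineOp, tsum_congr h, ENNReal.tsum_mul_right]
    ring

theorem tsum_siblingLaw_mul_half_pow_lt_one (hmean : ∑' k : ℕ, (k : ℝ≥0∞) * p k = 1)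
    {j : ℕ} (hj : 2 ≤ j) (hpj : p j ≠ 0) : ∑' m, siblingLaw p m * 2⁻¹ ^ m < 1 := by
  have hhalf : (2⁻¹ : ℝ≥0∞) ≤ 1 := ENNReal.inv_le_one.mpr one_le_two
  have hle : ∀ m, siblingLaw p m * 2⁻¹ ^ m ≤ siblingLaw p m := fun m =>
    mul_le_of_le_one_right' (pow_le_one₀ zero_le hhalf)
  have hne : ∑' m, siblingLaw p m ≠ ⊤ := by
    rw [tsum_siblingLaw hmean]
    exact ENNReal.one_ne_top
  obtain ⟨m, rfl⟩ := Nat.exists_eq_add_of_le' hj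
  rw [← tsum_siblingLaw hmean]
  refine ENNReal.tsum_lt_tsum (i := m + 1) (ne_top_of_le_ne_top hne (ENNReal.tsum_le_tsum hle))
    hle ?_
  have h0 : siblingLaw p (m + 1) ≠ 0 := mul_ne_zero (by positivity) hpj
  have ht : siblingLaw p (m + 1) ≠ ⊤ := ENNReal.ne_top_of_tsum_ne_top hne _
  calc siblingLaw p (m + 1) * 2⁻¹ ^ (m + 1) < siblingLaw p (m + 1) * 1 := by
        refine ENNReal.mul_lt_mul_right h0 ht ?_
        exact pow_lt_one₀ zero_le (ENNReal.inv_lt_one.mpr ENNReal.one_lt_two) m.succ_ne_zero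
    _ = _ := mul_one _

end SpineOp

theorem isCriticalLaw_toReal {p : ℕ → ℝ≥0∞} (hp : ∑' k : ℕ, p k = 1)
    (hmean : ∑' k : ℕ, (k : ℝ≥0∞) * p k = 1) (hvar_pos : 0 < xiVar p) (hvar_fin : xiVar p ≠ ⊤) :
    IsCriticalLaw (fun j => (p j).toReal) (xiVar p).toReal := by
  have key : ∀ f : ℕ → ℝ≥0∞, ∑' k, f k ≠ ⊤ →
      HasSum (fun k => (f k).toReal) (∑' k, f k).toReal := fun f hf => by
    rw [ENNReal.tsum_toReal_eq (ENNReal.ne_top_of_tsum_ne_top hf)]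
    exact ENNReal.hasSum_toReal hf
  refine ⟨fun j => ENNReal.toReal_nonneg, ?_, ?_, ?_, ENNReal.toReal_pos hvar_pos.ne' hvar_fin⟩
  · simpa [hp] using key p (by simp [hp])
  · simpa [hmean] using key (fun k => k * p k) (by simp [hmean])
  · have h := key _ hvar_fin
    refine h.congr_fun fun j => ?_
    rw [ENNReal.toReal_mul, ENNReal.toReal_ofReal (sq_nonneg _)]

theorem coeff_mk_ofReal_pow {r : ℕ → ℝ} (hr : ∀ j, 0 ≤ r j) (N s : ℕ) :
    coeff s (PowerSeries.mk (fun j => ENNReal.ofReal (r j)) ^ N) =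
      ENNReal.ofReal (coeff s (PowerSeries.mk r ^ N)) := by
  induction N generalizing s with
  | zero => rw [pow_zero, pow_zero, coeff_one, coeff_one]; split_ifs <;> simp
  | succ N ih =>
    rw [pow_succ, pow_succ, coeff_mul, coeff_mul, ENNReal.ofReal_sum_of_nonneg fun x _ =>
      mul_nonneg (coeff_mk_pow_nonneg hr _ _) (by simpa using hr _)]
    refine Finset.sum_congr rfl fun x _ => ?_
    rw [ih, ENNReal.ofReal_mul (coeff_mk_pow_nonneg hr _ _), coeff_mk, coeff_mk]

theorem coeff_treeSeries_pow_eq_ofReal {r : ℕ → ℝ} (hr : ∀ j, 0 ≤ r j) {N l : ℕ} (hN : 1 ≤ N)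
    (hl : l ≤ N) : coeff N (treeSeries (fun j => ENNReal.ofReal (r j)) ^ l) =
      ENNReal.ofReal (l * coeff (N - l) (PowerSeries.mk r ^ N) / N) := by
  have h := (natCast_mul_coeff_treeSeries_pow (fun j => ENNReal.ofReal (r j)) N l).1 hl
  have hN' : (0 : ℝ) < N := by exact_mod_cast hN
  rw [coeff_mk_ofReal_pow hr, ← ENNReal.ofReal_natCast l, ← ENNReal.ofReal_mul l.cast_nonneg] at h
  rw [ENNReal.ofReal_div_of_pos hN', ← h, ENNReal.ofReal_natCast, mul_comm,
    ENNReal.mul_div_cancel_right (by exact_mod_cast hN'.ne') (ENNReal.natCast_ne_top N)]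

namespace IsCriticalLaw

variable {r : ℕ → ℝ} {v : ℝ}

/-- Two polynomial bounds and one exponential bound for the hitting probabilities of the
associated left-continuous random walk. -/
theorem exists_coeff_treeSeries_pow_le (hr : IsCriticalLaw r v) : ∃ C : ℝ, 0 < C ∧ ∀ N l : ℕ,
    (1 ≤ N → coeff N (treeSeries (fun j => ENNReal.ofReal (r j)) ^ l) ≤
      ENNReal.ofReal (C / (N * √N)) * l) ∧
    (1 ≤ N → coeff N (treeSeries (fun j => ENNReal.ofReal (r j)) ^ l) ≤ ENNReal.ofReal (C / N)) ∧
    coeff N (treeSeries (fun j => ENNReal.ofReal (r j)) ^ l) ≤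
      ENNReal.ofReal (C * 2 ^ N) * 2⁻¹ ^ l := by
  obtain ⟨C₁, hC₁, h₁⟩ := hr.exists_coeff_pow_le
  obtain ⟨C₂, hC₂, h₂⟩ := hr.exists_abs_sub_mul_coeff_pow_le
  refine ⟨C₁ + C₂ + 1, by positivity, fun N l => ?_⟩
  rcases lt_or_ge N l with hl | hl
  · simp [(natCast_mul_coeff_treeSeries_pow _ N l).2 hl]
  have hhalf : (2⁻¹ : ℝ≥0∞) ^ l = ENNReal.ofReal (2⁻¹ ^ l) := by
    rw [ENNReal.ofReal_pow (by norm_num), ENNReal.ofReal_inv_of_pos two_pos, ENNReal.ofReal_ofNat]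
  rw [hhalf, ← ENNReal.ofReal_mul (by positivity), ← ENNReal.ofReal_natCast l]
  rcases Nat.eq_zero_or_pos N with rfl | hN
  · obtain rfl : l = 0 := by omega
    have : (1 : ℝ) ≤ C₁ + C₂ + 1 := by linarith
    simpa using this
  have hN1 : (1 : ℝ) ≤ N := by exact_mod_cast hN
  have hN' : (0 : ℝ) < N := by linarith
  have hs1 : 1 ≤ √(N : ℝ) := Real.one_le_sqrt.mpr hN1
  have hlN : (l : ℝ) ≤ N := by exact_mod_cast hl
  have hc := h₁ N hN (N - l)
  have hc0 := hr.coeff_pow_nonneg N (N - l)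
  have hd := (le_abs_self _).trans (h₂ N hN (N - l))
  rw [Nat.cast_sub hl, sub_sub_cancel] at hd
  rw [coeff_treeSeries_pow_eq_ofReal hr.nonneg hN hl, ← ENNReal.ofReal_mul (by positivity)]
  refine ⟨fun _ => ENNReal.ofReal_le_ofReal ?_, fun _ => ENNReal.ofReal_le_ofReal ?_,
    ENNReal.ofReal_le_ofReal ?_⟩
  · calc (l : ℝ) * coeff (N - l) (PowerSeries.mk r ^ N) / N
        ≤ l * ((C₁ + C₂ + 1) / √N) / N := by gcongr; exact hc.trans (by gcongr; linarith)
      _ = _ := by field_simp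
  · gcongr
    linarith
  · calc (l : ℝ) * coeff (N - l) (PowerSeries.mk r ^ N) / N
        ≤ N * coeff (N - l) (PowerSeries.mk r ^ N) / N := by gcongr
      _ = coeff (N - l) (PowerSeries.mk r ^ N) := by field_simp
      _ ≤ C₁ := hc.trans (div_le_self hC₁.le hs1)
      _ ≤ (C₁ + C₂ + 1) * 1 := by linarith
      _ ≤ (C₁ + C₂ + 1) * (2 ^ N * 2⁻¹ ^ l) := by
          refine mul_le_mul_of_nonneg_left ?_ (by positivity)
          rw [inv_pow, ← div_eq_mul_inv, one_le_div (by positivity)]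
          exact pow_le_pow_right₀ one_le_two hl
      _ = _ := by ring

theorem exists_le_probSize (hr : IsCriticalLaw r v) : ∃ c : ℝ, 0 < c ∧ ∀ n : ℕ, 1 ≤ n →
    probSize (fun j => ENNReal.ofReal (r j)) n ≠ 0 →
      ENNReal.ofReal (c / (n * √n)) ≤ probSize (fun j => ENNReal.ofReal (r j)) n := by
  obtain ⟨c, hc, h⟩ := hr.exists_le_coeff_pow
  refine ⟨c, hc, fun n hn hne => ?_⟩
  have e := coeff_treeSeries_pow_eq_ofReal hr.nonneg hn hn
  rw [pow_one, coeff_treeSeries, Nat.cast_one, one_mul] at e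
  rw [e] at hne ⊢
  refine ENNReal.ofReal_le_ofReal ?_
  rw [mul_comm, ← div_div]
  gcongr
  refine h n hn fun h0 => hne ?_
  rw [h0, zero_div, ENNReal.ofReal_zero]

end IsCriticalLaw

theorem exists_sq_mul_pow_le {ρ : ℝ} (h0 : 0 ≤ ρ) (h1 : ρ < 1) :
    ∃ A : ℝ, 0 < A ∧ ∀ j : ℕ, (j : ℝ) ^ 2 * ρ ^ j ≤ A := by
  obtain ⟨A, hA⟩ := (tendsto_pow_const_mul_const_pow_of_abs_lt_one 2
    (abs_lt.mpr ⟨by linarith, h1⟩)).bddAbove_range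
  exact ⟨max A 1, by positivity, fun j => (hA (mem_range_self j)).trans (le_max_left _ _)⟩

/-- If `k` is large compared to `N`, then `2 ^ N * ρ ^ k` decays faster than any power. -/
theorem exists_two_pow_mul_pow_le {ρ : ℝ} (h0 : 0 ≤ ρ) (h1 : ρ < 1) :
    ∃ s : ℕ, ∃ A : ℝ, 0 < A ∧ ∀ N k : ℕ, s * N < k →
      2 ^ N * ρ ^ k ≤ A / (((N + k : ℕ) : ℝ) * √(N + k : ℕ)) := by
  obtain ⟨s, hs⟩ := exists_pow_lt_of_lt_one (show (0 : ℝ) < 1 / 2 by norm_num) h1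
  obtain ⟨A, hA, hAle⟩ := exists_sq_mul_pow_le h0 h1
  refine ⟨2 * (s + 1), 16 * A, by positivity, fun N k hk => ?_⟩
  have hs' : ρ ^ (s + 1) ≤ 1 / 2 :=
    (pow_le_pow_of_le_one h0 h1.le (Nat.le_succ s)).trans hs.le
  obtain ⟨j, rfl⟩ : ∃ j, k = (s + 1) * N + j := Nat.exists_eq_add_of_le (by nlinarith)
  have hj : N + ((s + 1) * N + j) ≤ 4 * j := by nlinarith [Nat.zero_le (s * N)]
  have hn1 : 1 ≤ N + ((s + 1) * N + j) := by
    rw [mul_assoc] at hk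
    omega
  generalize hn : N + ((s + 1) * N + j) = n at *
  have hn1' : (1 : ℝ) ≤ n := by exact_mod_cast hn1
  have hj' : (n : ℝ) ≤ 4 * j := by exact_mod_cast hj
  have hsn : √(n : ℝ) ≤ n := Real.sqrt_le_iff.mpr ⟨by linarith, by nlinarith⟩
  have hsn0 : 0 < √(n : ℝ) := Real.sqrt_pos.mpr (by linarith)
  rw [le_div_iff₀ (by positivity)]
  have h2 : (2 : ℝ) ^ N * ρ ^ ((s + 1) * N + j) ≤ ρ ^ j := by
    rw [pow_add, pow_mul, ← mul_assoc, ← mul_pow]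
    refine mul_le_of_le_one_left (pow_nonneg h0 j) (pow_le_one₀ (by positivity) ?_)
    linarith
  calc (2 : ℝ) ^ N * ρ ^ ((s + 1) * N + j) * (n * √n) ≤ ρ ^ j * (n * n) := by gcongr
    _ ≤ ρ ^ j * (4 * j * (4 * j)) := by gcongr
    _ = 16 * (j ^ 2 * ρ ^ j) := by ring
    _ ≤ 16 * A := by gcongr; exact hAle j

theorem exists_coeff_levelSeries_le {r : ℕ → ℝ} {v : ℝ} (hr : IsCriticalLaw r v)
    (hmean : ∑' k : ℕ, (k : ℝ≥0∞) * ENNReal.ofReal (r k) = 1)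
    (hvar_fin : xiVar (fun j => ENNReal.ofReal (r j)) ≠ ⊤) :
    ∃ D : ℝ, 0 < D ∧ ∀ k n : ℕ, 1 ≤ k → 1 ≤ n →
      coeff n (weightedTreeSeries (fun j => ENNReal.ofReal (r j)) fun t => (levelCount t k : ℝ≥0∞))
        ≤ ENNReal.ofReal (D / (n * √n) * min (k : ℝ) √n) := by
  set p : ℕ → ℝ≥0∞ := fun j => ENNReal.ofReal (r j) with hp
  obtain ⟨C, hC, hB⟩ := hr.exists_coeff_treeSeries_pow_le
  obtain ⟨j, hj2, hj⟩ := hr.exists_two_le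
  have hρ := tsum_siblingLaw_mul_half_pow_lt_one (p := p) hmean hj2
    (ENNReal.ofReal_pos.mpr hj).ne'
  have hV := tsum_mul_siblingLaw_ne_top hmean hvar_fin
  have hlin := iterate_spineOp_linear hmean
  have hV0 := ENNReal.toReal_nonneg (a := ∑' m : ℕ, (m : ℝ≥0∞) * siblingLaw p m)
  have hρ0 := ENNReal.toReal_nonneg (a := ∑' m, siblingLaw p m * 2⁻¹ ^ m)
  have hρ1 : (∑' m, siblingLaw p m * 2⁻¹ ^ m).toReal < 1 := by
    simpa using ENNReal.toReal_strict_mono ENNReal.one_ne_top hρ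
  rw [← ENNReal.ofReal_toReal hV] at hlin
  have hgeo := fun a => iterate_spineOp_geometric p a 2⁻¹
  rw [← ENNReal.ofReal_toReal hρ.ne_top] at hgeo
  generalize (∑' m : ℕ, (m : ℝ≥0∞) * siblingLaw p m).toReal = V at hlin hV0
  generalize (∑' m, siblingLaw p m * 2⁻¹ ^ m).toReal = ρ at hgeo hρ0 hρ1
  obtain ⟨s, A, hA, hdecay⟩ := exists_two_pow_mul_pow_le hρ0 hρ1
  refine ⟨C * (1 + V) * ((s : ℝ) + 1) ^ 2 + C * (s + 1) + C * A, by positivity,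
    fun k n hk hn => ?_⟩
  rcases lt_or_ge n k with hnk | hnk
  · rw [coeff_levelSeries_of_lt p hnk]
    exact zero_le
  obtain ⟨N, rfl⟩ := Nat.exists_eq_add_of_le' hnk
  rw [coeff_levelSeries]
  have hk1 : (1 : ℝ) ≤ k := by exact_mod_cast hk
  have hn1 : (1 : ℝ) ≤ (N + k : ℕ) := by exact_mod_cast hn
  have hs1 : 1 ≤ √((N + k : ℕ) : ℝ) := Real.one_le_sqrt.mpr hn1
  have hmin : 1 ≤ min (k : ℝ) √((N + k : ℕ) : ℝ) := le_min hk1 hs1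
  rcases lt_or_ge (s * N) k with hkN | hkN
  · refine ((spineOp_mono p).iterate k (fun l => (hB N l).2.2) 1).trans ?_
    rw [hgeo]
    beta_reduce
    rw [pow_one, ← ENNReal.ofReal_pow hρ0, ← ENNReal.ofReal_mul (by positivity)]
    refine (mul_le_of_le_one_right' (ENNReal.inv_le_one.mpr one_le_two)).trans
      (ENNReal.ofReal_le_ofReal ?_)
    calc C * 2 ^ N * ρ ^ k = C * (2 ^ N * ρ ^ k) := by ring
      _ ≤ C * (A / (((N + k : ℕ) : ℝ) * √(N + k : ℕ))) := by gcongr; exact hdecay N k hkN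
      _ = C * A / (((N + k : ℕ) : ℝ) * √(N + k : ℕ)) * 1 := by ring
      _ ≤ _ := by
        gcongr
        exact le_add_of_nonneg_left (by positivity)
  · have hN : 1 ≤ N := by
      rcases Nat.eq_zero_or_pos N with rfl | h
      · omega
      · exact h
    have hN' : (0 : ℝ) < N := by exact_mod_cast hN
    have hsN : 0 < √(N : ℝ) := Real.sqrt_pos.mpr hN'
    have hnM : ((N + k : ℕ) : ℝ) ≤ (s + 1) * N := by
      have : N + k ≤ (s + 1) * N := by linarith
      exact_mod_cast this
    have hsM : √((N + k : ℕ) : ℝ) ≤ (s + 1) * √N := by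
      refine (Real.sqrt_le_sqrt hnM).trans ?_
      rw [Real.sqrt_mul (by positivity)]
      gcongr
      exact Real.sqrt_le_iff.mpr ⟨by positivity, by nlinarith [s.cast_nonneg (α := ℝ)]⟩
    have h1 := (spineOp_mono p).iterate k (fun l => (hB N l).1 hN) 1
    have h2 := (spineOp_mono p).iterate k (fun l => (hB N l).2.1 hN) 1
    rw [hlin] at h1
    rw [iterate_spineOp_const hmean] at h2
    rw [mul_min_of_nonneg _ _ (by positivity), ENNReal.ofReal_min]
    refine le_min (h1.trans ?_) (h2.trans (ENNReal.ofReal_le_ofReal ?_))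
    · beta_reduce
      rw [← ENNReal.ofReal_natCast, ← ENNReal.ofReal_natCast, ← ENNReal.ofReal_mul (by positivity),
        ← ENNReal.ofReal_add (by positivity) (by positivity), ← ENNReal.ofReal_mul (by positivity)]
      refine ENNReal.ofReal_le_ofReal ?_
      have hprod : ((N + k : ℕ) : ℝ) * √(N + k : ℕ) ≤ ((s : ℝ) + 1) ^ 2 * (N * √N) := by
        calc _ ≤ ((s : ℝ) + 1) * N * ((s + 1) * √N) := by gcongr
          _ = _ := by ring
      calc C / (N * √N) * (((1 : ℕ) : ℝ) + k * V) ≤ C / (N * √N) * ((1 + V) * k) := by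
            gcongr
            push_cast
            linarith
        _ = C * (1 + V) * ((s : ℝ) + 1) ^ 2 / (((s : ℝ) + 1) ^ 2 * (N * √N)) * k := by field_simp
        _ ≤ C * (1 + V) * ((s : ℝ) + 1) ^ 2 / (((N + k : ℕ) : ℝ) * √(N + k : ℕ)) * k := by gcongr
        _ ≤ _ := by
            gcongr
            rw [add_assoc]
            exact le_add_of_nonneg_right (by positivity)
    · calc C / N = C * (s + 1) / ((s + 1) * N) := by field_simp
        _ ≤ C * (s + 1) / (N + k : ℕ) := by gcongr
        _ = C * (s + 1) / (((N + k : ℕ) : ℝ) * √(N + k : ℕ)) * √(N + k : ℕ) := by field_simp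
        _ ≤ _ := by
            gcongr
            rw [add_right_comm]
            exact le_add_of_nonneg_left (by positivity)

end

/-- Lemma 5 of Devroye–Janson.  `E Z_k(T_n) ≤ C min(k, √n)` uniformly
in `k, n ≥ 1`. -/
theorem expected_levelCount_le
    (p : ℕ → ℝ≥0∞) (hp : ∑' k : ℕ, p k = 1)
    (hmean : ∑' k : ℕ, (k : ℝ≥0∞) * p k = 1)
    (hvar_pos : 0 < xiVar p) (hvar_fin : xiVar p ≠ ⊤) :
    ∃ C : ℝ, 0 < C ∧ ∀ k n : ℕ, 1 ≤ k → 1 ≤ n → probSize p n ≠ 0 →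
      condExp p n (fun t => (levelCount t k : ℝ≥0∞))
        ≤ ENNReal.ofReal (C * min (k : ℝ) (Real.sqrt n)) := by
  obtain ⟨r, v, hr, rfl⟩ : ∃ r v, IsCriticalLaw r v ∧ p = fun j => ENNReal.ofReal (r j) := by
    refine ⟨_, _, isCriticalLaw_toReal hp hmean hvar_pos hvar_fin, funext fun j => ?_⟩
    rw [ENNReal.ofReal_toReal (ENNReal.ne_top_of_tsum_ne_top (by simp [hp]) j)]
  obtain ⟨D, hD, hup⟩ := exists_coeff_levelSeries_le hr hmean hvar_fin
  obtain ⟨c, hc, hlow⟩ := hr.exists_le_probSize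
  refine ⟨D / c, by positivity, fun k n hk hn hne => ENNReal.div_le_of_le_mul ?_⟩
  have h := hup k n hk hn
  rw [weightedTreeSeries, PowerSeries.coeff_mk] at h
  refine h.trans (le_trans ?_ (mul_le_mul_right (hlow n hn hne) _))
  rw [← ENNReal.ofReal_mul (by positivity)]
  refine ENNReal.ofReal_le_ofReal (le_of_eq ?_)
  have hn' : (0 : ℝ) < n := by exact_mod_cast hn
  have hsn : 0 < √(n : ℝ) := Real.sqrt_pos.mpr hn'
  generalize min (k : ℝ) √n = x
  field_simp
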